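/- arXiv:2407.07189 — 19 statements merged into one kernel-verified Lean document; each statement's English description precedes it below -/
import Mathlib

section
/- Let X be a set, let S : X ⇒ X be a set-valued map satisfying the non-stationarity condition, let h : X × X → [0,∞) satisfy h(x,y) = 0 if and only if x = y, and let x₀ ∈ X. Then at least one of the following holds: (1) there is a finite S-orbit x₀, x₁, …, xₙ with S(xₙ) = ∅; (2) there is an infinite S-orbit {xᵢ}_{i≥0} starting at x₀ such that h(x_{i+1}, xᵢ) > min{1, sup h(S(xᵢ), xᵢ)}/2 for every i ≥ 0, where sup h(S(xᵢ), xᵢ) denotes sup_{y ∈ S(xᵢ)} h(y, xᵢ). -/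
open Filter Topology ENNReal

/-- Lemma 2 (loev-induction). -/
theorem stmt_0 {X : Type*} (S : X → Set X) (hS : ∀ x : X, x ∉ S x)
    (h : X → X → ℝ) (hnn : ∀ x y : X, 0 ≤ h x y)
    (hzero : ∀ x y : X, h x y = 0 ↔ x = y) (x₀ : X) :
    (∃ (n : ℕ) (x : ℕ → X), x 0 = x₀ ∧ (∀ i < n, x (i + 1) ∈ S (x i)) ∧ S (x n) = ∅) ∨
    (∃ x : ℕ → X, x 0 = x₀ ∧ (∀ i, x (i + 1) ∈ S (x i)) ∧
      ∀ i, min 1 (⨆ y ∈ S (x i), ENNReal.ofReal (h y (x i))) / 2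
        < ENNReal.ofReal (h (x (i + 1)) (x i))) := by
  classical
  have key : ∀ x : X, ∃ y, (S x).Nonempty → y ∈ S x ∧
      min 1 (⨆ y ∈ S x, ENNReal.ofReal (h y x)) / 2 < ENNReal.ofReal (h y x) := by
    intro x
    by_cases hne : (S x).Nonempty
    · obtain ⟨z, hz⟩ := hne
      have hpos : 0 < ENNReal.ofReal (h z x) := by
        rw [ENNReal.ofReal_pos]
        refine lt_of_le_of_ne (hnn z x) fun h0 => hS x ?_
        have hzx := (hzero z x).1 h0.symm
        rwa [hzx] at hz
      have hsup : 0 < ⨆ y ∈ S x, ENNReal.ofReal (h y x) :=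
        lt_of_lt_of_le hpos (le_iSup₂ (f := fun y (_ : y ∈ S x) => ENNReal.ofReal (h y x)) z hz)
      have hlt : min 1 (⨆ y ∈ S x, ENNReal.ofReal (h y x)) / 2
          < ⨆ y ∈ S x, ENNReal.ofReal (h y x) := by
        refine lt_of_lt_of_le (ENNReal.half_lt_self ?_ ?_) (min_le_right 1 _)
        · exact (lt_min one_pos hsup).ne'
        · exact ne_top_of_le_ne_top ENNReal.one_ne_top (min_le_left _ _)
      obtain ⟨y, hy⟩ := lt_iSup_iff.1 hlt
      obtain ⟨hyS, hy⟩ := lt_iSup_iff.1 hy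
      exact ⟨y, fun _ => ⟨hyS, hy⟩⟩
    · exact ⟨x, fun h => absurd h hne⟩
  choose f hf using key
  have hstep : ∀ i, f^[i + 1] x₀ = f (f^[i] x₀) := fun i => Function.iterate_succ_apply' f i x₀
  by_cases hex : ∃ n, S (f^[n] x₀) = ∅
  · left
    refine ⟨Nat.find hex, fun i => f^[i] x₀, rfl, fun i hi => ?_, Nat.find_spec hex⟩
    have := (hf _ (Set.nonempty_iff_ne_empty.2 (Nat.find_min hex hi))).1
    simpa only [hstep] using this
  · right
    push Not at hex
    refine ⟨fun i => f^[i] x₀, rfl, fun i => ?_, fun i => ?_⟩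
    · simpa only [hstep] using (hf _ (hex i)).1
    · simpa only [hstep] using (hf _ (hex i)).2
end

section
/- Let (X, τ, h) be an h-space and let S : X ⇒ X satisfy property (∗₁) at x₀ ∈ X. Let {xᵢ}_{i=0}^∞ be an infinite S-orbit starting at x₀ that converges to a point x̄ ∈ X. If lim_{i→∞} sup_{y ∈ S(xᵢ)} h(y, xᵢ) = 0, then S(x̄) = ∅. -/
open Filter Topology

/-- Lemma (to0-empty). In an h-space, if an infinite S-orbit starting at x₀
converges to x̄ and sup h(S(xᵢ),xᵢ) → 0, then S(x̄) = ∅, provided S satisfies (∗₁) at x₀. -/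
theorem stmt_1 {X : Type*} [TopologicalSpace X] [T2Space X]
    [FirstCountableTopology X]
    (h : X → X → ℝ) (hnn : ∀ x y : X, 0 ≤ h x y)
    (hi : ∀ x y : X, h x y = 0 ↔ x = y)
    (hii : ∀ (x : X) (u : ℕ → X),
      Tendsto (fun n => h x (u n)) atTop (𝓝 0) → Tendsto u atTop (𝓝 x))
    (hiii : ∀ (x : X) (u : ℕ → X),
      Tendsto u atTop (𝓝 x) → Tendsto (fun n => h (u (n + 1)) (u n)) atTop (𝓝 0))
    (S : X → Set X) (x₀ : X)
    (hS0 : ∀ x : X, x ∉ S x)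
    (hS1 : ∀ u : ℕ → X, u 0 = x₀ → (∀ i, u (i + 1) ∈ S (u i)) →
      ∀ x : X, Tendsto u atTop (𝓝 x) →
      ∀ y ∈ S x, ∃ φ : ℕ → ℕ, StrictMono φ ∧ ∀ k, y ∈ S (u (φ k)))
    (u : ℕ → X) (hu0 : u 0 = x₀) (hu : ∀ i, u (i + 1) ∈ S (u i))
    (xbar : X) (hconv : Tendsto u atTop (𝓝 xbar))
    (hsup : Tendsto (fun i => ⨆ y ∈ S (u i), ENNReal.ofReal (h y (u i))) atTop (𝓝 0)) :
    S xbar = ∅ := by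
  refine Set.eq_empty_iff_forall_notMem.mpr fun y hy => ?_
  obtain ⟨φ, hφ, hyS⟩ := hS1 u hu0 hu xbar hconv y hy
  have h1 : Tendsto (fun k => ENNReal.ofReal (h y (u (φ k)))) atTop (𝓝 0) := by
    refine tendsto_of_tendsto_of_tendsto_of_le_of_le tendsto_const_nhds
      (hsup.comp hφ.tendsto_atTop) (fun _ => zero_le) (fun k => ?_)
    exact le_iSup₂ (f := fun z (_ : z ∈ S (u (φ k))) => ENNReal.ofReal (h z (u (φ k)))) y (hyS k)
  have h2 : Tendsto (fun k => h y (u (φ k))) atTop (𝓝 0) := by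
    have h3 := (ENNReal.tendsto_toReal ENNReal.zero_ne_top).comp h1
    simpa [Function.comp_def, ENNReal.toReal_ofReal, hnn] using h3
  have h4 : y = xbar :=
    tendsto_nhds_unique (hii y _ h2) (hconv.comp hφ.tendsto_atTop)
  exact hS0 xbar (h4 ▸ hy)
end

section
/- Let (X, τ, h) be an h-space and let S : X ⇒ X be a set-valued map satisfying property (∗₁) at x₀ ∈ X. Then at least one of the following is true: (a) there is a divergent S-orbit starting at x₀ (an infinite S-orbit whose sequence of points does not converge); (b) there is an S-orbit starting at x₀ and ending at some x ∈ X such that S(x) = ∅. -/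
open Filter Topology

/-- Theorem (loev-topo). In an h-space, if S satisfies (∗₁) at x₀, then either
there is a divergent S-orbit starting at x₀, or there is an S-orbit starting at x₀
and ending at some x with S(x) = ∅. -/
theorem stmt_2 {X : Type*} [TopologicalSpace X] [T2Space X] [FirstCountableTopology X]
    (h : X → X → ℝ) (hnn : ∀ x y : X, 0 ≤ h x y)
    (hi : ∀ x y : X, h x y = 0 ↔ x = y)
    (hii : ∀ (x : X) (u : ℕ → X),
      Tendsto (fun n => h x (u n)) atTop (𝓝 0) → Tendsto u atTop (𝓝 x))
    (hiii : ∀ (x : X) (u : ℕ → X),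
      Tendsto u atTop (𝓝 x) → Tendsto (fun n => h (u (n + 1)) (u n)) atTop (𝓝 0))
    (S : X → Set X) (x₀ : X)
    (hS0 : ∀ x : X, x ∉ S x)
    (hS1 : ∀ u : ℕ → X, u 0 = x₀ → (∀ i, u (i + 1) ∈ S (u i)) →
      ∀ x : X, Tendsto u atTop (𝓝 x) →
      ∀ y ∈ S x, ∃ φ : ℕ → ℕ, StrictMono φ ∧ ∀ k, y ∈ S (u (φ k))) :
    (∃ u : ℕ → X, u 0 = x₀ ∧ (∀ i, u (i + 1) ∈ S (u i)) ∧
        ¬ ∃ x : X, Tendsto u atTop (𝓝 x)) ∨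
    (∃ x : X, S x = ∅ ∧
      ((∃ (n : ℕ) (u : ℕ → X), u 0 = x₀ ∧ (∀ i < n, u (i + 1) ∈ S (u i)) ∧ u n = x) ∨
       (∃ u : ℕ → X, u 0 = x₀ ∧ (∀ i, u (i + 1) ∈ S (u i)) ∧ Tendsto u atTop (𝓝 x)))) := by
  classical
  by_contra hcon
  rw [not_or] at hcon
  obtain ⟨hA, hB⟩ := hcon
  -- greedy choice of a successor
  have key : ∀ x : X, (S x).Nonempty →
      ∃ z ∈ S x, ∀ y ∈ S x, min 1 (h y x) ≤ 2 * h z x := by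
    intro x hx
    set T : Set ℝ := (fun y => min 1 (h y x)) '' S x with hT
    have hbdd : BddAbove T := ⟨1, by rintro _ ⟨y, _, rfl⟩; exact min_le_left _ _⟩
    obtain ⟨y0, hy0⟩ := hx
    have hpos : 0 < h y0 x := by
      refine lt_of_le_of_ne (hnn _ _) fun h0 => ?_
      have := (hi y0 x).1 h0.symm
      subst this
      exact hS0 _ hy0
    have hsup : 0 < sSup T :=
      lt_of_lt_of_le (lt_min one_pos hpos) (le_csSup hbdd ⟨y0, hy0, rfl⟩)
    obtain ⟨_, ⟨z, hz, rfl⟩, hlt⟩ :=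
      exists_lt_of_lt_csSup (s := T) ⟨_, ⟨y0, hy0, rfl⟩⟩ (half_lt_self hsup)
    refine ⟨z, hz, fun y hy => ?_⟩
    have h1 : min 1 (h y x) ≤ sSup T := le_csSup hbdd ⟨y, hy, rfl⟩
    have h2 : min 1 (h z x) ≤ h z x := min_le_right _ _
    have h3 : sSup T / 2 < min 1 (h z x) := hlt
    linarith
  have key2 : ∀ x : X, ∃ z, (S x).Nonempty →
      z ∈ S x ∧ ∀ y ∈ S x, min 1 (h y x) ≤ 2 * h z x := by
    intro x
    by_cases hx : (S x).Nonempty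
    · obtain ⟨z, hz⟩ := key x hx
      exact ⟨z, fun _ => hz⟩
    · exact ⟨x, fun hx' => absurd hx' hx⟩
  choose c hc using key2
  let u : ℕ → X := fun n => c^[n] x₀
  have hus : ∀ n, u (n + 1) = c (u n) := fun n => Function.iterate_succ_apply' c n x₀
  have hne : ∀ n, (S (u n)).Nonempty := by
    intro n
    induction n using Nat.strong_induction_on with
    | _ n ih =>
      by_contra hn
      refine hB ⟨u n, Set.not_nonempty_iff_eq_empty.1 hn, Or.inl ⟨n, u, rfl, ?_, rfl⟩⟩
      intro i hin
      rw [hus]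
      exact (hc _ (ih i hin)).1
  have horb : ∀ i, u (i + 1) ∈ S (u i) := fun i => by
    rw [hus]; exact (hc _ (hne i)).1
  have hconv : ∃ x : X, Tendsto u atTop (𝓝 x) := by
    by_contra hn
    exact hA ⟨u, rfl, horb, hn⟩
  obtain ⟨x, hx⟩ := hconv
  have hSx : (S x).Nonempty := by
    by_contra hn
    exact hB ⟨x, Set.not_nonempty_iff_eq_empty.1 hn, Or.inr ⟨u, rfl, horb, hx⟩⟩
  obtain ⟨y, hy⟩ := hSx
  obtain ⟨φ, hφ, hyφ⟩ := hS1 u rfl horb x hx y hy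
  have h0 : Tendsto (fun k => 2 * h (u (φ k + 1)) (u (φ k))) atTop (𝓝 0) := by
    have := ((hiii x u hx).comp hφ.tendsto_atTop).const_mul 2
    simpa using this
  have hle : ∀ k, min 1 (h y (u (φ k))) ≤ 2 * h (u (φ k + 1)) (u (φ k)) := fun k => by
    rw [hus]; exact (hc _ (hne _)).2 y (hyφ k)
  have hlim : Tendsto (fun k => h y (u (φ k))) atTop (𝓝 0) := by
    refine squeeze_zero' (Eventually.of_forall fun k => hnn _ _) ?_ h0
    filter_upwards [h0.eventually (gt_mem_nhds one_pos)] with k hk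
    rcases min_le_iff.1 (hle k) with h1 | h1
    · linarith
    · exact h1
  have hxy : y = x :=
    tendsto_nhds_unique (hii y (fun k => u (φ k)) hlim) (hx.comp hφ.tendsto_atTop)
  subst hxy
  exact hS0 _ hy
end

section
/- Let (X, τ, h) be an h-space. Then for every sequence {xₙ} in X and every x ∈ X, one has xₙ → x in τ if and only if h(x, xₙ) → 0. -/
open Filter Topology

/-- Proposition (h-def-top). In an h-space, xₙ → x if and only if h(x, xₙ) → 0. -/
theorem stmt_3 {X : Type*} [TopologicalSpace X] [T2Space X] [FirstCountableTopology X]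
    (h : X → X → ℝ) (hnn : ∀ x y : X, 0 ≤ h x y)
    (hi : ∀ x y : X, h x y = 0 ↔ x = y)
    (hii : ∀ (x : X) (u : ℕ → X),
      Tendsto (fun n => h x (u n)) atTop (𝓝 0) → Tendsto u atTop (𝓝 x))
    (hiii : ∀ (x : X) (u : ℕ → X),
      Tendsto u atTop (𝓝 x) → Tendsto (fun n => h (u (n + 1)) (u n)) atTop (𝓝 0)) :
    ∀ (u : ℕ → X) (x : X),
      Tendsto u atTop (𝓝 x) ↔ Tendsto (fun n => h x (u n)) atTop (𝓝 0) := by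
  intro u x
  refine ⟨fun hu => ?_, hii x u⟩
  -- interleave `u` with the constant sequence `x`
  have hv : Tendsto (fun n => if n % 2 = 0 then u (n / 2) else x) atTop (𝓝 x) := by
    intro s hs
    obtain ⟨N, hN⟩ := eventually_atTop.1 (hu hs)
    refine eventually_atTop.2 ⟨2 * N, fun n hn => ?_⟩
    show (if n % 2 = 0 then u (n / 2) else x) ∈ s
    split_ifs
    · exact hN (n / 2) (by omega)
    · exact mem_of_mem_nhds hs
  have h2 : Tendsto (fun n : ℕ => 2 * n) atTop atTop :=
    tendsto_atTop_mono (fun n => by simp only [id]; omega) tendsto_id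
  refine ((hiii x _ hv).comp h2).congr fun n => ?_
  simp [Function.comp]
end

section
/- Let (X, τ, h) be an h-space and let S : X ⇒ X be a set-valued map satisfying property (∗₂) at x₀ ∈ X. Then at least one of the following is true: (a) there is an S-orbit {xᵢ} starting at x₀ whose closure is not entirely contained in dom S = {x : S(x) ≠ ∅}; (b) there is a divergent S-orbit {xᵢ}_{i=0}^∞ starting at x₀ with limsup_{i→∞} h(x_{i+1}, xᵢ) > 0; (c) there is an infinite S-orbit starting at x₀ that is discrete as a set (closed and all points isolated). -/
open Filter Topology

/-- Proposition (pro:loev-topo). In an h-space, if S satisfies (∗₂) at x₀, then: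
(a) some S-orbit starting at x₀ has closure not contained in dom S, or
(b) there is a divergent S-orbit starting at x₀ with limsup h(x_{i+1},xᵢ) > 0, or
(c) there is an infinite discrete S-orbit starting at x₀. -/
theorem stmt_4 {X : Type*} [TopologicalSpace X] [T2Space X] [FirstCountableTopology X]
    (h : X → X → ℝ) (hnn : ∀ x y : X, 0 ≤ h x y)
    (hi : ∀ x y : X, h x y = 0 ↔ x = y)
    (hii : ∀ (x : X) (u : ℕ → X),
      Tendsto (fun n => h x (u n)) atTop (𝓝 0) → Tendsto u atTop (𝓝 x))
    (hiii : ∀ (x : X) (u : ℕ → X),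
      Tendsto u atTop (𝓝 x) → Tendsto (fun n => h (u (n + 1)) (u n)) atTop (𝓝 0))
    (S : X → Set X) (x₀ : X)
    (hS0 : ∀ x : X, x ∉ S x)
    (hS2 : ∀ u : ℕ → X, u 0 = x₀ → (∀ i, u (i + 1) ∈ S (u i)) →
      ∀ φ : ℕ → ℕ, StrictMono φ → ∀ x : X, Tendsto (u ∘ φ) atTop (𝓝 x) →
      ∀ y ∈ S x, ∃ ψ : ℕ → ℕ, StrictMono ψ ∧ ∀ j, y ∈ S (u (φ (ψ j)))) :
    -- (a) an S-orbit (finite or infinite) starting at x₀ whose closure is not inside dom S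
    ((∃ (n : ℕ) (u : ℕ → X), u 0 = x₀ ∧ (∀ i < n, u (i + 1) ∈ S (u i)) ∧
        ¬ closure (u '' Set.Iic n) ⊆ {x : X | (S x).Nonempty}) ∨
     (∃ u : ℕ → X, u 0 = x₀ ∧ (∀ i, u (i + 1) ∈ S (u i)) ∧
        ¬ closure (Set.range u) ⊆ {x : X | (S x).Nonempty})) ∨
    -- (b) a divergent S-orbit starting at x₀ with limsup h(x_{i+1}, xᵢ) > 0
    (∃ u : ℕ → X, u 0 = x₀ ∧ (∀ i, u (i + 1) ∈ S (u i)) ∧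
      (¬ ∃ x : X, Tendsto u atTop (𝓝 x)) ∧
      0 < Filter.limsup (fun i => ENNReal.ofReal (h (u (i + 1)) (u i))) atTop) ∨
    -- (c) an infinite discrete S-orbit starting at x₀
    (∃ u : ℕ → X, u 0 = x₀ ∧ (∀ i, u (i + 1) ∈ S (u i)) ∧
      IsClosed (Set.range u) ∧ ∀ p ∈ Set.range u, 𝓝[Set.range u \ {p}] p = ⊥) := by
  classical
  by_contra hcon
  simp only [not_or] at hcon
  obtain ⟨⟨ha1, ha2⟩, hb, hc⟩ := hcon
  have greedy : ∀ x : X, ∃ y, (S x).Nonempty →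
      (y ∈ S x ∧ ∀ z ∈ S x, min (h z x) 1 ≤ 2 * h y x) := by
    intro x
    by_cases hx : (S x).Nonempty
    · set T : Set ℝ := (fun z => min (h z x) 1) '' S x with hT
      have hbd : BddAbove T := ⟨1, by rintro _ ⟨z, _, rfl⟩; exact min_le_right _ _⟩
      have hne : T.Nonempty := hx.image _
      have hpos : 0 < sSup T := by
        obtain ⟨z, hz⟩ := hx
        have h1 : 0 < h z x := by
          refine lt_of_le_of_ne (hnn z x) fun he => ?_
          have := (hi z x).1 he.symm
          subst this
          exact hS0 _ hz
        exact lt_of_lt_of_le (lt_min h1 one_pos) (le_csSup hbd ⟨z, hz, rfl⟩)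
      obtain ⟨_, ⟨y, hy, rfl⟩, hlt⟩ := exists_lt_of_lt_csSup hne (half_lt_self hpos)
      refine ⟨y, fun _ => ⟨hy, fun z hz => ?_⟩⟩
      have h1 : min (h z x) 1 ≤ sSup T := le_csSup hbd ⟨z, hz, rfl⟩
      have h2 : min (h y x) 1 ≤ h y x := min_le_left _ _
      simp only at hlt
      linarith
    · exact ⟨x, fun hh => absurd hh hx⟩
  choose f hf using greedy
  let u : ℕ → X := fun n => f^[n] x₀
  have hu0 : u 0 = x₀ := rfl
  have hus : ∀ n, u (n + 1) = f (u n) := fun n => Function.iterate_succ_apply' f n x₀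
  have hdom : ∀ n, (S (u n)).Nonempty := by
    intro n
    induction n using Nat.strong_induction_on with
    | _ n ih =>
      by_contra hn
      refine ha1 ⟨n, u, hu0, fun i hin => ?_, fun hsub => ?_⟩
      · rw [hus]; exact (hf _ (ih i hin)).1
      · exact hn (hsub (subset_closure ⟨n, le_refl n, rfl⟩))
  have horb : ∀ i, u (i + 1) ∈ S (u i) := fun i => by
    rw [hus]; exact (hf _ (hdom i)).1
  have hlim : Tendsto (fun n => h (u (n + 1)) (u n)) atTop (𝓝 0) := by
    by_cases hconv : ∃ x : X, Tendsto u atTop (𝓝 x)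
    · obtain ⟨x, hx⟩ := hconv
      exact hiii x u hx
    · have hl : limsup (fun i => ENNReal.ofReal (h (u (i + 1)) (u i))) atTop ≤ 0 := by
        by_contra hl
        exact hb ⟨u, hu0, horb, hconv, not_le.1 hl⟩
      have ht : Tendsto (fun i => ENNReal.ofReal (h (u (i + 1)) (u i))) atTop (𝓝 0) :=
        tendsto_of_le_liminf_of_limsup_le (zero_le) hl
      have := (ENNReal.tendsto_toReal ENNReal.zero_ne_top).comp ht
      simpa [Function.comp_def, ENNReal.toReal_ofReal, hnn] using this
  have hclu : ∀ x, ¬ MapClusterPt x atTop u := by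
    intro x hx
    obtain ⟨φ, hφ, hφx⟩ := TopologicalSpace.FirstCountableTopology.tendsto_subseq hx
    have hxd : (S x).Nonempty := by
      by_contra hn
      refine ha2 ⟨u, hu0, horb, fun hsub => hn (hsub ?_)⟩
      exact mem_closure_of_tendsto hφx (Eventually.of_forall fun n => ⟨φ n, rfl⟩)
    obtain ⟨y, hy⟩ := hxd
    obtain ⟨ψ, hψ, hψy⟩ := hS2 u hu0 horb φ hφ x hφx y hy
    have hg : Tendsto (fun j => 2 * h (u (φ (ψ j) + 1)) (u (φ (ψ j)))) atTop (𝓝 0) := by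
      have := (hlim.comp ((hφ.comp hψ).tendsto_atTop)).const_mul 2
      simpa [Function.comp_def] using this
    have hle : ∀ j, min (h y (u (φ (ψ j)))) 1 ≤ 2 * h (u (φ (ψ j) + 1)) (u (φ (ψ j))) := by
      intro j
      rw [hus]
      exact (hf _ (hdom _)).2 y (hψy j)
    have hy0 : Tendsto (fun j => h y (u (φ (ψ j)))) atTop (𝓝 0) := by
      refine tendsto_of_tendsto_of_tendsto_of_le_of_le' tendsto_const_nhds hg
        (Eventually.of_forall fun j => hnn _ _) ?_
      filter_upwards [hg.eventually (gt_mem_nhds one_pos)] with j hj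
      rcases min_le_iff.1 (hle j) with h1 | h1
      · exact h1
      · linarith
    have hty := hii y _ hy0
    have htx : Tendsto (fun j => u (φ (ψ j))) atTop (𝓝 x) := hφx.comp hψ.tendsto_atTop
    have := tendsto_nhds_unique hty htx
    subst this
    exact hS0 _ hy
  have hdisc : ∀ p, 𝓝[Set.range u \ {p}] p = ⊥ := by
    intro p
    have hp := hclu p
    rw [mapClusterPt_iff_frequently] at hp
    push Not at hp
    obtain ⟨U, hU, hev⟩ := hp
    obtain ⟨N, hN⟩ := eventually_atTop.1 hev
    have hfin : ((u '' Set.Iio N) \ {p}).Finite := ((Set.finite_Iio N).image u).subset Set.diff_subset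
    have hV : ((u '' Set.Iio N) \ {p})ᶜ ∈ 𝓝 p :=
      hfin.isClosed.isOpen_compl.mem_nhds (by simp)
    rw [← empty_mem_iff_bot, mem_nhdsWithin_iff_exists_mem_nhds_inter]
    refine ⟨_, inter_mem hU hV, ?_⟩
    rintro _ ⟨⟨h1, h2⟩, ⟨n, rfl⟩, h3⟩
    refine h2 ⟨⟨n, ?_, rfl⟩, h3⟩
    by_contra hn
    exact hN n (not_lt.1 hn) h1
  refine hc ⟨u, hu0, horb, ?_, fun p _ => hdisc p⟩
  refine isClosed_of_closure_subset fun p hp => ?_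
  by_contra hpr
  have := hdisc p
  rw [Set.diff_singleton_eq_self hpr] at this
  exact (mem_closure_iff_nhdsWithin_neBot.1 hp).ne this
end

section
/- Let (X, τ, g) be a Σ_g-semicomplete premetric space and let S : X ⇒ X satisfy property (∗₂) at x₀ ∈ X. Then at least one of the following is true: (a) there is an S-orbit starting at x₀ with infinite g-length; (b) there is an S-orbit starting at x₀ with finite g-length whose closure is not contained in dom S = {x : S(x) ≠ ∅}. -/
open Filter Topology

/-- Theorem (LOEV) in a Σ_g-semicomplete premetric space. If S satisfies (∗₂)
at x₀, then either (a) some S-orbit starting at x₀ has infinite g-length, or (b) some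
S-orbit starting at x₀ has finite g-length and its closure is not contained in dom S. -/
theorem stmt_5 {X : Type*} [TopologicalSpace X] [FirstCountableTopology X]
    (g : X → X → ℝ)
    (hg0 : ∀ x : X, g x x = 0) (hgpos : ∀ x y : X, x ≠ y → 0 < g x y)
    (hgcont : ∀ x : X, Continuous (g x))
    (hsemi : ∀ u : ℕ → X, Summable (fun i => g (u (i + 1)) (u i)) →
      ∃ φ : ℕ → ℕ, StrictMono φ ∧ ∃ x : X, Tendsto (u ∘ φ) atTop (𝓝 x))
    (S : X → Set X) (x₀ : X)
    (hS0 : ∀ x : X, x ∉ S x)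
    (hS2 : ∀ u : ℕ → X, u 0 = x₀ → (∀ i, u (i + 1) ∈ S (u i)) →
      ∀ φ : ℕ → ℕ, StrictMono φ → ∀ x : X, Tendsto (u ∘ φ) atTop (𝓝 x) →
      ∀ y ∈ S x, ∃ ψ : ℕ → ℕ, StrictMono ψ ∧ ∀ j, y ∈ S (u (φ (ψ j)))) :
    -- (a) an infinite S-orbit starting at x₀ with infinite g-length
    (∃ u : ℕ → X, u 0 = x₀ ∧ (∀ i, u (i + 1) ∈ S (u i)) ∧
        ¬ Summable (fun i => g (u (i + 1)) (u i))) ∨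
    -- (b) an S-orbit starting at x₀ with finite g-length whose closure is not inside dom S
    ((∃ (n : ℕ) (u : ℕ → X), u 0 = x₀ ∧ (∀ i < n, u (i + 1) ∈ S (u i)) ∧
        ¬ closure (u '' Set.Iic n) ⊆ {x : X | (S x).Nonempty}) ∨
     (∃ u : ℕ → X, u 0 = x₀ ∧ (∀ i, u (i + 1) ∈ S (u i)) ∧
        Summable (fun i => g (u (i + 1)) (u i)) ∧
        ¬ closure (Set.range u) ⊆ {x : X | (S x).Nonempty})) := by
  by_contra hcon
  push Not at hcon
  obtain ⟨ha, hb, hc⟩ := hcon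
  have sel : ∀ x, ∃ z, (S x).Nonempty → z ∈ S x ∧ ∀ y ∈ S x, min 1 (g y x) ≤ 2 * g z x := by
    intro x
    by_cases hx : (S x).Nonempty
    · have hbdd : BddAbove ((fun y => min 1 (g y x)) '' S x) := by
        refine ⟨1, ?_⟩
        rintro _ ⟨y, _, rfl⟩
        exact min_le_left _ _
      have hle : ∀ y ∈ S x, min 1 (g y x) ≤ sSup ((fun y => min 1 (g y x)) '' S x) :=
        fun y hy => le_csSup hbdd ⟨y, hy, rfl⟩
      have hpos : 0 < sSup ((fun y => min 1 (g y x)) '' S x) := by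
        obtain ⟨y, hy⟩ := hx
        refine lt_of_lt_of_le (lt_min one_pos (hgpos y x ?_)) (hle y hy)
        rintro rfl
        exact hS0 _ hy
      obtain ⟨_, ⟨z, hz, rfl⟩, hlt⟩ := exists_lt_of_lt_csSup (hx.image _) (half_lt_self hpos)
      refine ⟨z, fun _ => ⟨hz, fun y hy => ?_⟩⟩
      have h1 := hle y hy
      have h2 : min 1 (g z x) ≤ g z x := min_le_right _ _
      simp only at hlt
      linarith
    · exact ⟨x, fun h => absurd h hx⟩
  choose f hf using sel
  let u : ℕ → X := fun n => f^[n] x₀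
  have hu0 : u 0 = x₀ := rfl
  have hus : ∀ i, u (i + 1) = f (u i) := fun i => Function.iterate_succ_apply' f i x₀
  have hdom : ∀ n, (S (u n)).Nonempty := by
    intro n
    induction n using Nat.strong_induction_on with
    | _ n ih =>
      have := hb n u hu0 (fun i hi => by rw [hus]; exact (hf _ (ih i hi)).1)
      exact this (subset_closure ⟨n, Set.mem_Iic.2 le_rfl, rfl⟩)
  have horb : ∀ i, u (i + 1) ∈ S (u i) := fun i => by rw [hus]; exact (hf _ (hdom i)).1
  have hsum := ha u hu0 horb
  obtain ⟨φ, hφ, x, hx⟩ := hsemi u hsum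
  have hxd : (S x).Nonempty := hc u hu0 horb hsum
    (mem_closure_of_tendsto hx (Eventually.of_forall fun n => ⟨φ n, rfl⟩))
  obtain ⟨y, hy⟩ := hxd
  obtain ⟨ψ, hψ, hmem⟩ := hS2 u hu0 horb φ hφ x hx y hy
  have h1 : Tendsto (fun j => min 1 (g y (u (φ (ψ j))))) atTop (𝓝 (min 1 (g y x))) :=
    tendsto_const_nhds.min (((hgcont y).tendsto x).comp (hx.comp hψ.tendsto_atTop))
  have h2 : Tendsto (fun j => 2 * g (u (φ (ψ j) + 1)) (u (φ (ψ j)))) atTop (𝓝 (2 * 0)) :=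
    (hsum.tendsto_atTop_zero.comp (hφ.comp hψ).tendsto_atTop).const_mul 2
  have h3 : min 1 (g y x) ≤ 2 * 0 := by
    refine le_of_tendsto_of_tendsto' h1 h2 fun j => ?_
    rw [hus]
    exact (hf _ (hdom _)).2 y (hmem j)
  have h4 : 0 < min 1 (g y x) := by
    refine lt_min one_pos (hgpos y x ?_)
    rintro rfl
    exact hS0 _ hy
  linarith
end

section
/- Let (X, τ, g) be a first countable premetric space that is not Σ_g-semicomplete. Then there exists a countable discrete set M = {xₙ : n ∈ ℕ} ⊂ X (with the xₙ pairwise distinct) such that the sequence {xₙ}_{n=1}^∞ has finite g-length, and there exists a strictly positive lower semicontinuous function f : X → (0, +∞] with dom f = M, inf_X f = 0, and f(xₙ) − f(x_{n+1}) = g(x_{n+1}, xₙ) for all n ∈ ℕ. -/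
open Filter Topology ENNReal

/-- Lemma (rem:1). If a first countable premetric space is not
Σ_g-semicomplete, there is a countable discrete set M = {xₙ} (pairwise distinct) whose
sequence has finite g-length, and a strictly positive lower semicontinuous
f : X → (0,+∞] with dom f = M, inf f = 0, and f(xₙ) − f(x_{n+1}) = g(x_{n+1}, xₙ). -/
theorem stmt_6 {X : Type*} [TopologicalSpace X] [FirstCountableTopology X]
    (g : X → X → ℝ)
    (hg0 : ∀ x : X, g x x = 0) (hgpos : ∀ x y : X, x ≠ y → 0 < g x y)
    (hgcont : ∀ x : X, Continuous (g x))
    (hnot : ¬ ∀ u : ℕ → X, Summable (fun i => g (u (i + 1)) (u i)) →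
      ∃ φ : ℕ → ℕ, StrictMono φ ∧ ∃ x : X, Tendsto (u ∘ φ) atTop (𝓝 x)) :
    ∃ x : ℕ → X, Function.Injective x ∧
      Summable (fun n => g (x (n + 1)) (x n)) ∧
      IsClosed (Set.range x) ∧
      (∀ p ∈ Set.range x, 𝓝[Set.range x \ {p}] p = ⊥) ∧
      ∃ f : X → ℝ≥0∞, (∀ p : X, 0 < f p) ∧ LowerSemicontinuous f ∧
        {p : X | f p ≠ ⊤} = Set.range x ∧
        (⨅ p : X, f p) = 0 ∧
        ∀ n : ℕ, f (x n) = f (x (n + 1)) + ENNReal.ofReal (g (x (n + 1)) (x n)) := by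
  classical
  have hnn : ∀ a b, 0 ≤ g a b := by
    intro a b
    by_cases h : a = b
    · subst h; exact (hg0 a).ge
    · exact (hgpos a b h).le
  haveI : T1Space X := by
    refine ⟨fun a => ?_⟩
    have h : ({a} : Set X) = g a ⁻¹' {0} := by
      ext b
      simp only [Set.mem_singleton_iff, Set.mem_preimage]
      constructor
      · rintro rfl; exact hg0 _
      · intro hb
        by_contra hne
        exact (hgpos a b (fun h => hne h.symm)).ne hb.symm
    rw [h]
    exact isClosed_singleton.preimage (hgcont a)
  push Not at hnot
  obtain ⟨u, hu, hno⟩ := hnot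
  have hclus : ∀ p, ¬ MapClusterPt p atTop u := by
    intro p hp
    obtain ⟨φ, hφ, ht⟩ := TopologicalSpace.FirstCountableTopology.tendsto_subseq hp
    exact hno φ hφ p ht
  have hev : ∀ p, ∃ U ∈ 𝓝 p, ∃ N, ∀ n, N ≤ n → u n ∉ U := by
    intro p
    have h := hclus p
    rw [mapClusterPt_iff_frequently] at h
    push Not at h
    obtain ⟨U, hU, h⟩ := h
    obtain ⟨N, hN⟩ := eventually_atTop.1 h
    exact ⟨U, hU, N, hN⟩
  -- last occurrence
  have hlast : ∀ k, ∃ m, k ≤ m ∧ u m = u k ∧ ∀ j, m < j → u j ≠ u m := by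
    intro k
    obtain ⟨U, hU, N, hN⟩ := hev (u k)
    have hb : ∀ j, u j = u k → j ≤ N := by
      intro j hj
      by_contra hlt
      exact hN j (by omega) (hj ▸ mem_of_mem_nhds hU)
    refine ⟨Nat.findGreatest (fun j => u j = u k) N, ?_, ?_, ?_⟩
    · exact Nat.le_findGreatest (hb k rfl) rfl
    · exact Nat.findGreatest_spec (P := fun j => u j = u k) (hb k rfl) rfl
    · intro j hj he
      have h2 : u (Nat.findGreatest (fun j => u j = u k) N) = u k :=
        Nat.findGreatest_spec (P := fun j => u j = u k) (hb k rfl) rfl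
      have h3 : u j = u k := he.trans h2
      have h4 := Nat.le_findGreatest (P := fun j => u j = u k) (hb j h3) h3
      omega
  choose L hL1 hL2 hL3 using hlast
  let n : ℕ → ℕ := fun i => Nat.rec (L 0) (fun _ k => L (k + 1)) i
  have hnsucc : ∀ i, n (i + 1) = L (n i + 1) := fun _ => rfl
  have hnmono : StrictMono n := strictMono_nat_of_lt_succ (fun i => by
    rw [hnsucc]; exact Nat.lt_of_succ_le (hL1 _))
  have hnlast : ∀ i j, n i < j → u j ≠ u (n i) := by
    intro i
    cases i with
    | zero => exact hL3 0
    | succ i => rw [hnsucc]; exact hL3 _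
  have hstep : ∀ i, g (u (n (i + 1))) (u (n i)) = g (u (n i + 1)) (u (n i)) := by
    intro i
    rw [hnsucc, hL2]
  obtain ⟨x, hx⟩ : ∃ x : ℕ → X, x = fun i => u (n i) := ⟨_, rfl⟩
  have hinj : Function.Injective x := by
    intro i j hij
    simp only [hx] at hij
    rcases lt_trichotomy i j with h | h | h
    · exact absurd hij.symm (hnlast i _ (hnmono h))
    · exact h
    · exact absurd hij (hnlast j _ (hnmono h))
  have hsum : Summable (fun i => g (x (i + 1)) (x i)) := by
    have h := hu.comp_injective hnmono.injective
    refine h.congr (fun i => ?_)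
    simp only [hx, Function.comp, hstep]
  have hlf : LocallyFinite (fun i => ({x i} : Set X)) := by
    intro p
    obtain ⟨U, hU, N, hN⟩ := hev p
    refine ⟨U, hU, (Set.finite_lt_nat N).subset ?_⟩
    rintro i ⟨y, hy, hyU⟩
    rw [Set.mem_singleton_iff] at hy
    subst hy
    by_contra hlt
    have hlt' : N ≤ i := not_lt.1 hlt
    exact hN (n i) (hlt'.trans (hnmono.id_le i)) (by simpa [hx] using hyU)
  have hcl : ∀ S : Set X, S ⊆ Set.range x → IsClosed S := by
    intro S hS
    have h : S = ⋃ i, ({x i} ∩ S) := by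
      ext p
      simp only [Set.mem_iUnion, Set.mem_inter_iff, Set.mem_singleton_iff]
      constructor
      · intro hp
        obtain ⟨i, rfl⟩ := hS hp
        exact ⟨i, rfl, hp⟩
      · rintro ⟨i, _, hp⟩
        exact hp
    rw [h]
    exact (hlf.subset (fun i => Set.inter_subset_left)).isClosed_iUnion
      (fun i => ((Set.finite_singleton (x i)).subset Set.inter_subset_left).isClosed)
  let a : ℕ → ℝ≥0∞ := fun i => ENNReal.ofReal (g (x (i + 1)) (x i))
  have hasum : ∑' i, a i ≠ ⊤ := hsum.tsum_ofReal_ne_top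
  have hapos : ∀ i, 0 < a i := fun i =>
    ENNReal.ofReal_pos.2 (hgpos _ _ (fun h => by have := hinj h; omega))
  let F : ℕ → ℝ≥0∞ := fun k => ∑' i, a (i + k)
  have hFtop : ∀ k, F k ≠ ⊤ := fun k =>
    ne_top_of_le_ne_top hasum (ENNReal.tsum_comp_le_tsum_of_injective (add_left_injective k) a)
  have hFpos : ∀ k, 0 < F k := fun k =>
    lt_of_lt_of_le (hapos (0 + k)) (ENNReal.le_tsum (f := fun i => a (i + k)) 0)
  have hFs : ∀ k, F k = F (k + 1) + a k := by
    intro k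
    simp only [F]
    rw [tsum_eq_zero_add' ENNReal.summable, add_comm, zero_add]
    simp only [add_assoc, add_comm 1 k]
  let f : X → ℝ≥0∞ := Function.extend x F (fun _ => ⊤)
  have hfx : ∀ k, f (x k) = F k := fun k => hinj.extend_apply _ _ _
  have hfn : ∀ p, p ∉ Set.range x → f p = ⊤ := fun p hp =>
    Function.extend_apply' _ _ _ (fun ⟨i, hi⟩ => hp ⟨i, hi⟩)
  refine ⟨x, hinj, hsum, hcl _ subset_rfl, ?_, f, ?_, ?_, ?_, ?_, ?_⟩
  · intro p _
    rw [← notMem_closure_iff_nhdsWithin_eq_bot, (hcl _ Set.diff_subset).closure_eq]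
    simp
  · intro p
    by_cases hp : p ∈ Set.range x
    · obtain ⟨i, rfl⟩ := hp
      rw [hfx]; exact hFpos i
    · rw [hfn p hp]; exact ENNReal.zero_lt_top
  · rw [lowerSemicontinuous_iff_isClosed_preimage]
    intro y
    by_cases hy : y = ⊤
    · subst hy; simp
    · apply hcl
      intro p hp
      by_contra hpr
      have h : f p ≤ y := hp
      rw [hfn p hpr, top_le_iff] at h
      exact hy h
  · ext p
    constructor
    · intro hp
      by_contra hpr
      exact hp (hfn p hpr)
    · rintro ⟨i, rfl⟩
      show f (x i) ≠ ⊤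
      rw [hfx]; exact hFtop i
  · have ht : Tendsto F atTop (𝓝 0) := ENNReal.tendsto_sum_nat_add a hasum
    refine le_antisymm (ge_of_tendsto' ht (fun k => ?_)) zero_le
    rw [← hfx k]
    exact iInf_le f (x k)
  · intro k
    rw [hfx, hfx]
    exact hFs k
end

section
/- (Caristi-type theorem) Let (X, τ, g) be a Σ_g-semicomplete premetric space. Let T : X ⇒ X be a set-valued map with T(x) ≠ ∅ for all x ∈ X, and let f : X → ℝ ∪ {+∞} be proper, lower semicontinuous and bounded below. Assume that for every x ∈ X there exists y ∈ T(x) such that g(y, x) ≤ f(x) − f(y). Then T has a fixed point, i.e. there exists x̄ ∈ X with x̄ ∈ T(x̄). -/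
open Filter Topology

/-- Caristi-type theorem in a Σ_g-semicomplete premetric space.
The Caristi condition g(y,x) ≤ f(x) − f(y) is rendered as f(y) + g(y,x) ≤ f(x)
in the extended reals. -/
theorem stmt_8 {X : Type*} [TopologicalSpace X] [FirstCountableTopology X]
    (g : X → X → ℝ)
    (hg0 : ∀ x : X, g x x = 0) (hgpos : ∀ x y : X, x ≠ y → 0 < g x y)
    (hgcont : ∀ x : X, Continuous (g x))
    (hsemi : ∀ u : ℕ → X, Summable (fun i => g (u (i + 1)) (u i)) →
      ∃ φ : ℕ → ℕ, StrictMono φ ∧ ∃ x : X, Tendsto (u ∘ φ) atTop (𝓝 x))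
    (T : X → Set X) (hT : ∀ x : X, (T x).Nonempty)
    (f : X → EReal)
    (hproper : ∃ x : X, f x ≠ ⊤)
    (hlsc : LowerSemicontinuous f)
    (hbdd : ∃ c : ℝ, ∀ x : X, (c : EReal) ≤ f x)
    (hcaristi : ∀ x : X, ∃ y ∈ T x, f y + (g y x : EReal) ≤ f x) :
    ∃ xbar : X, xbar ∈ T xbar := by
  classical
  by_contra hno
  obtain ⟨c, hc⟩ := hbdd
  have hgnn : ∀ x y, 0 ≤ g x y := by
    intro x y
    by_cases h : x = y
    · subst h; rw [hg0]
    · exact (hgpos x y h).le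
  let F : X → ℝ := fun x => (f x).toReal
  have hbot : ∀ x, f x ≠ ⊥ := fun x h => by
    have := hc x
    rw [h] at this
    exact EReal.coe_ne_bot c (le_bot_iff.1 this)
  have hF : ∀ x, f x ≠ ⊤ → f x = (F x : EReal) := fun x hx =>
    (EReal.coe_toReal hx (hbot x)).symm
  have hFc : ∀ x, f x ≠ ⊤ → c ≤ F x := fun x hx => by
    have := hc x
    rw [hF x hx] at this
    exact_mod_cast this
  -- real-valued Caristi condition
  have hcar : ∀ x, f x ≠ ⊤ → ∃ y, f y ≠ ⊤ ∧ y ≠ x ∧ F y + g y x ≤ F x := by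
    intro x hx
    obtain ⟨y, hy, h⟩ := hcaristi x
    have hyt : f y ≠ ⊤ := by
      intro ht
      rw [ht, EReal.top_add_coe] at h
      exact hx (top_le_iff.1 h)
    refine ⟨y, hyt, ?_, ?_⟩
    · rintro rfl
      exact hno ⟨y, hy⟩
    · rw [hF x hx, hF y hyt] at h
      exact_mod_cast h
  -- almost minimising step
  have hstep : ∀ x : {x // f x ≠ ⊤}, ∃ z : {x // f x ≠ ⊤},
      g z x ≤ 2 * (F x - F z) ∧
      ∀ y, f y ≠ ⊤ → g y x ≤ 2 * (F x - F y) → 2 * F z ≤ F x + F y := by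
    rintro ⟨x, hx⟩
    let S : Set ℝ := F '' {y | f y ≠ ⊤ ∧ g y x ≤ 2 * (F x - F y)}
    have hxS : F x ∈ S := ⟨x, ⟨hx, by simp [hg0]⟩, rfl⟩
    have hSb : BddBelow S := ⟨c, by rintro _ ⟨y, hy, rfl⟩; exact hFc y hy.1⟩
    have hm : ∀ y, f y ≠ ⊤ → g y x ≤ 2 * (F x - F y) → sInf S ≤ F y :=
      fun y h1 h2 => csInf_le hSb ⟨y, ⟨h1, h2⟩, rfl⟩
    rcases (csInf_le hSb hxS).eq_or_lt with he | hl
    · refine ⟨⟨x, hx⟩, by simp [hg0], fun y h1 h2 => ?_⟩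
      have := hm y h1 h2
      show 2 * F x ≤ F x + F y
      linarith
    · obtain ⟨_, ⟨z, hz, rfl⟩, hz2⟩ := exists_lt_of_csInf_lt ⟨_, hxS⟩
        (show sInf S < (F x + sInf S) / 2 by linarith)
      refine ⟨⟨z, hz.1⟩, hz.2, fun y h1 h2 => ?_⟩
      have := hm y h1 h2
      show 2 * F z ≤ F x + F y
      linarith
  choose s hs1 hs2 using hstep
  obtain ⟨x0, hx0⟩ := hproper
  let v : ℕ → {x // f x ≠ ⊤} := fun n => s^[n] ⟨x0, hx0⟩
  have hv : ∀ n, v (n + 1) = s (v n) := fun n => Function.iterate_succ_apply' s n _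
  let u : ℕ → X := fun n => (v n : X)
  have hu1 : ∀ n, g (u (n + 1)) (u n) ≤ 2 * (F (u n) - F (u (n + 1))) := by
    intro n
    have := hs1 (v n)
    rw [← hv] at this
    exact this
  have hu2 : ∀ n y, f y ≠ ⊤ → g y (u n) ≤ 2 * (F (u n) - F y) →
      2 * F (u (n + 1)) ≤ F (u n) + F y := by
    intro n
    have := hs2 (v n)
    rw [← hv] at this
    exact this
  have hut : ∀ n, f (u n) ≠ ⊤ := fun n => (v n).2
  have hanti : Antitone (fun n => F (u n)) := antitone_nat_of_succ_le fun n => by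
    have := hu1 n
    have := hgnn (u (n + 1)) (u n)
    linarith
  have hsum : Summable (fun i => g (u (i + 1)) (u i)) := by
    refine summable_of_sum_range_le (c := 2 * (F (u 0) - c)) (fun _ => hgnn _ _) fun n => ?_
    have h : ∑ i ∈ Finset.range n, g (u (i + 1)) (u i) ≤ 2 * (F (u 0) - F (u n)) := by
      induction n with
      | zero => simp
      | succ n ih =>
        rw [Finset.sum_range_succ]
        have := hu1 n
        linarith
    have := hFc _ (hut n)
    linarith
  obtain ⟨φ, hφ, x, hx⟩ := hsemi u hsum
  have hle : ∀ n, f x ≤ (F (u n) : EReal) := by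
    intro n
    have hcl : IsClosed (f ⁻¹' Set.Iic (F (u n) : EReal)) := hlsc.isClosed_preimage _
    refine hcl.mem_of_tendsto hx ?_
    filter_upwards [eventually_ge_atTop n] with k hk
    show f (u (φ k)) ≤ _
    rw [hF _ (hut _)]
    exact_mod_cast hanti (hk.trans (hφ.id_le k))
  have hxt : f x ≠ ⊤ := fun h => by
    have := hle 0
    rw [h] at this
    exact EReal.coe_ne_top _ (top_le_iff.1 this)
  have hleF : ∀ n, F x ≤ F (u n) := fun n => by
    have := hle n
    rw [hF x hxt] at this
    exact_mod_cast this
  obtain ⟨y, hyt, hyx, hy⟩ := hcar x hxt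
  have hp := hgpos y x hyx
  have hlim : Tendsto (fun n => F (u n)) atTop (𝓝 (⨅ n, F (u n))) :=
    tendsto_atTop_ciInf hanti ⟨c, by rintro _ ⟨n, rfl⟩; exact hFc _ (hut n)⟩
  have hgl : Tendsto (fun k => g y (u (φ k))) atTop (𝓝 (g y x)) :=
    ((hgcont y).tendsto x).comp hx
  have hev : ∀ᶠ k in atTop, 2 * F (u (φ k + 1)) ≤ F (u (φ k)) + F y := by
    filter_upwards [hgl.eventually_lt_const (show g y x < 2 * g y x by linarith)] with k hk
    refine hu2 _ y hyt ?_
    have := hleF (φ k)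
    linarith
  have hA := hlim.comp hφ.tendsto_atTop
  have hB := (hlim.comp (tendsto_add_atTop_nat 1)).comp hφ.tendsto_atTop
  have h1 := le_of_tendsto_of_tendsto (hB.const_mul 2) (hA.add_const (F y)) hev
  have h2 : F x ≤ ⨅ n, F (u n) := le_ciInf hleF
  linarith
end

section
/- Let (X, τ, g) be a first countable premetric space. Suppose that every set-valued map T : X ⇒ X with nonempty values satisfying the Caristi condition (for every x ∈ X there exists y ∈ T(x) with g(y, x) ≤ f(x) − f(y)) for some proper, lower semicontinuous and bounded below function f : X → ℝ ∪ {+∞}, has a fixed point. Then (X, τ, g) is Σ_g-semicomplete. -/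
open Filter Topology

/-- Theorem (Caristi inverse). If in a first countable premetric space every
set-valued map T with nonempty values satisfying the Caristi condition for some proper,
lower semicontinuous, bounded below f has a fixed point, then the space is Σ_g-semicomplete. -/
theorem stmt_9 {X : Type*} [TopologicalSpace X] [FirstCountableTopology X]
    (g : X → X → ℝ)
    (hg0 : ∀ x : X, g x x = 0) (hgpos : ∀ x y : X, x ≠ y → 0 < g x y)
    (hgcont : ∀ x : X, Continuous (g x))
    (hyp : ∀ T : X → Set X, (∀ x : X, (T x).Nonempty) →
      (∃ f : X → EReal, (∃ x : X, f x ≠ ⊤) ∧ LowerSemicontinuous f ∧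
        (∃ c : ℝ, ∀ x : X, (c : EReal) ≤ f x) ∧
        ∀ x : X, ∃ y ∈ T x, f y + (g y x : EReal) ≤ f x) →
      ∃ xbar : X, xbar ∈ T xbar) :
    -- Σ_g-semicompleteness
    ∀ u : ℕ → X, Summable (fun i => g (u (i + 1)) (u i)) →
      ∃ φ : ℕ → ℕ, StrictMono φ ∧ ∃ x : X, Tendsto (u ∘ φ) atTop (𝓝 x) := by
  classical
  intro u hu
  by_contra hno
  have hnn : ∀ x y, 0 ≤ g x y := fun x y => by
    by_cases h : x = y
    · rw [h, hg0]
    · exact (hgpos x y h).le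
  have : T1Space X := ⟨fun x => by
    have h : ({x} : Set X) = g x ⁻¹' {0} := by
      ext y
      simp only [Set.mem_singleton_iff, Set.mem_preimage]
      constructor
      · rintro rfl
        exact hg0 _
      · intro h
        by_contra hne
        exact (hgpos x y (Ne.symm hne)).ne' h
    rw [h]
    exact isClosed_singleton.preimage (hgcont x)⟩
  have hev : ∀ x : X, ∃ V ∈ 𝓝 x, ∃ N, ∀ n ≥ N, u n ∉ V := by
    intro x
    by_contra hc
    apply hno
    have hcl : MapClusterPt x atTop u := by
      rw [mapClusterPt_iff_frequently]
      intro s hs hf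
      apply hc
      obtain ⟨N, hN⟩ := eventually_atTop.1 hf
      exact ⟨s, hs, N, hN⟩
    obtain ⟨φ, hφ, ht⟩ := MapClusterPt.tendsto_subseq hcl
    exact ⟨φ, hφ, x, ht⟩
  have hlast : ∀ x : X, ∃ n, (∃ k, u k = x) → u n = x ∧ ∀ m, u m = x → m ≤ n := by
    intro x
    by_cases hx : ∃ k, u k = x
    · obtain ⟨V, hV, N, hN⟩ := hev x
      have hfin : {n | u n = x}.Finite := by
        apply (Set.finite_lt_nat N).subset
        intro n hn
        by_contra hlt
        apply hN n (not_lt.1 hlt)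
        rw [show u n = x from hn]
        exact mem_of_mem_nhds hV
      obtain ⟨n, hn, hmax⟩ := Set.exists_max_image _ id hfin hx
      exact ⟨n, fun _ => ⟨hn, fun m hm => hmax m hm⟩⟩
    · exact ⟨0, fun h => absurd h hx⟩
  choose L hL using hlast
  let S : ℕ → ℝ := fun n => -∑ i ∈ Finset.range n, g (u (i + 1)) (u i)
  have hSanti : Antitone S := antitone_nat_of_succ_le fun n => by
    simp only [S, Finset.sum_range_succ]
    linarith [hnn (u (n + 1)) (u n)]
  let f : X → EReal := fun x => if ∃ k, u k = x then ((S (L x) : ℝ) : EReal) else ⊤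
  let T : X → Set X := fun x => if ∃ k, u k = x then {u (L x + 1)} else {u 0}
  have hf : (∃ x : X, f x ≠ ⊤) ∧ LowerSemicontinuous f ∧
        (∃ c : ℝ, ∀ x : X, (c : EReal) ≤ f x) ∧
        ∀ x : X, ∃ y ∈ T x, f y + (g y x : EReal) ≤ f x := by
    refine ⟨⟨u 0, by simp [f]⟩, ?_, ?_, ?_⟩
    · intro x c hc
      obtain ⟨V, hV, N, hN⟩ := hev x
      have hfin : ((u '' {n | n < N}) \ {x}).Finite := ((Set.finite_lt_nat N).image u).subset Set.diff_subset
      have hW : ((u '' {n | n < N}) \ {x})ᶜ ∈ 𝓝 x := hfin.isClosed.isOpen_compl.mem_nhds (by simp)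
      filter_upwards [hV, hW] with y hy hyW
      by_cases hyx : y = x
      · rwa [hyx]
      · have : ¬ ∃ k, u k = y := by
          rintro ⟨k, rfl⟩
          apply hyW
          refine ⟨⟨k, ?_, rfl⟩, hyx⟩
          by_contra hlt
          exact hN k (not_lt.1 hlt) hy
        simp only [f, if_neg this]
        exact lt_of_lt_of_le hc le_top
    · refine ⟨-∑' i, g (u (i + 1)) (u i), fun x => ?_⟩
      by_cases h : ∃ k, u k = x
      · simp only [f, if_pos h]
        rw [EReal.coe_le_coe_iff]
        exact neg_le_neg (hu.sum_le_tsum _ fun i _ => hnn _ _)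
      · simp only [f, if_neg h]
        exact le_top
    · intro x
      by_cases h : ∃ k, u k = x
      · refine ⟨u (L x + 1), by simp only [T, if_pos h, Set.mem_singleton_iff], ?_⟩
        have h2 : ∃ k, u k = u (L x + 1) := ⟨_, rfl⟩
        simp only [f, if_pos h, if_pos h2]
        rw [← EReal.coe_add, EReal.coe_le_coe_iff]
        have h3 := hSanti ((hL _ h2).2 _ rfl)
        have h4 : S (L x + 1) = S (L x) - g (u (L x + 1)) (u (L x)) := by
          simp only [S, Finset.sum_range_succ]
          ring
        rw [(hL x h).1] at h4
        linarith
      · refine ⟨u 0, by simp only [T, if_neg h, Set.mem_singleton_iff], ?_⟩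
        simp only [f, if_neg h]
        exact le_top
  obtain ⟨x, hx⟩ := hyp T (fun x => by
      by_cases h : ∃ k, u k = x <;> simp [T, h]) ⟨f, hf⟩
  · by_cases h : ∃ k, u k = x
    · simp only [T, if_pos h, Set.mem_singleton_iff] at hx
      have := (hL x h).2 _ hx.symm
      omega
    · simp only [T, if_neg h, Set.mem_singleton_iff] at hx
      exact h ⟨0, hx.symm⟩
end

section
/- (Takahashi-type theorem) Let (X, τ, g) be a Σ_g-semicomplete premetric space and let f : X → ℝ ∪ {+∞} be proper, lower semicontinuous and bounded below. Suppose that for each x ∈ X with f(x) > inf_X f there exists y ∈ X, y ≠ x, such that g(y, x) ≤ f(x) − f(y). Then there exists v ∈ X with f(v) = inf_X f. -/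
open Filter Topology

/-- A chain of transitive-closure steps can be interpolated to a genuine `r`-sequence. -/
theorem aux_interp {α : Type*} (r : α → α → Prop) (p : ℕ → α)
    (h : ∀ n, ∃ L : ℕ, 0 < L ∧ ∃ w : ℕ → α, w 0 = p n ∧ w L = p (n + 1) ∧
      ∀ i < L, r (w i) (w (i + 1))) :
    ∃ (u : ℕ → α) (K : ℕ → ℕ), StrictMono K ∧ (∀ n, u (K n) = p n) ∧
      ∀ k, r (u k) (u (k + 1)) := by
  choose L hL w w0 wL hw using h
  let nx : ℕ × ℕ → ℕ × ℕ := fun q => if q.2 + 1 < L q.1 then (q.1, q.2 + 1) else (q.1 + 1, 0)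
  let st : ℕ → ℕ × ℕ := fun k => nx^[k] (0, 0)
  have st_succ : ∀ k, st (k + 1) = nx (st k) := fun k => Function.iterate_succ_apply' nx k _
  have inv : ∀ k, (st k).2 < L (st k).1 := by
    intro k
    induction k with
    | zero => exact hL 0
    | succ k ih =>
      rw [st_succ]
      simp only [nx]
      split_ifs with h1
      · exact h1
      · exact hL _
  have adv : ∀ n k, st k = (n, 0) → ∀ i, i < L n → st (k + i) = (n, i) := by
    intro n k hk i
    induction i with
    | zero => intro _; simpa using hk
    | succ i ih =>
      intro hi
      rw [← add_assoc, st_succ, ih (by omega)]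
      simp [nx, hi]
  have adv2 : ∀ n k, st k = (n, 0) → st (k + L n) = (n + 1, 0) := by
    intro n k hk
    obtain ⟨l, hl⟩ : ∃ l, L n = l + 1 := ⟨L n - 1, by have := hL n; omega⟩
    rw [hl, ← add_assoc, st_succ, adv n k hk l (by omega)]
    simp [nx, hl]
  let K : ℕ → ℕ := fun n => ∑ i ∈ Finset.range n, L i
  have hK : ∀ n, st (K n) = (n, 0) := by
    intro n
    induction n with
    | zero => simp [K, st]
    | succ n ih =>
      have := adv2 n _ ih
      simpa [K, Finset.sum_range_succ] using this
  refine ⟨fun k => w (st k).1 (st k).2, K, ?_, ?_, ?_⟩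
  · refine strictMono_nat_of_lt_succ fun n => ?_
    simp [K, Finset.sum_range_succ, hL n]
  · intro n
    simp [hK, w0]
  · intro k
    have h1 := inv k
    have h2 := hw _ _ h1
    simp only [st_succ]
    by_cases h3 : (st k).2 + 1 < L (st k).1
    · simpa [nx, h3] using h2
    · have h4 : (st k).2 + 1 = L (st k).1 := by omega
      simp only [nx, h3, if_false, w0]
      rw [h4, wL] at h2
      exact h2

theorem aux_path {α : Type*} (r : α → α → Prop) {a b : α} (hb : r b b)
    (h : Relation.ReflTransGen r a b) :
    ∃ L : ℕ, 0 < L ∧ ∃ w : ℕ → α, w 0 = a ∧ w L = b ∧ ∀ i < L, r (w i) (w (i + 1)) := by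
  induction h using Relation.ReflTransGen.head_induction_on with
  | refl => exact ⟨1, one_pos, fun _ => b, rfl, rfl, fun _ _ => hb⟩
  | head h1 _ ih =>
    rename_i a c _
    obtain ⟨L, hL, w, w0, wL, hw⟩ := ih
    refine ⟨L + 1, by omega, fun i => Nat.casesOn i a w, rfl, wL, ?_⟩
    intro i hi
    cases i with
    | zero => simpa [w0] using h1
    | succ i => exact hw i (by omega)

/-- Real-valued version on a domain `D`. -/
theorem aux_main {X : Type*} [TopologicalSpace X] (g : X → X → ℝ)
    (hg0 : ∀ x : X, g x x = 0) (hgpos : ∀ x y : X, x ≠ y → 0 < g x y)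
    (hgcont : ∀ x : X, Continuous (g x))
    (hsemi : ∀ u : ℕ → X, Summable (fun i => g (u (i + 1)) (u i)) →
      ∃ φ : ℕ → ℕ, StrictMono φ ∧ ∃ x : X, Tendsto (u ∘ φ) atTop (𝓝 x))
    (D : Set X) (F : X → ℝ) (x0 : X) (hx0 : x0 ∈ D) (c : ℝ) (hc : ∀ x ∈ D, c ≤ F x)
    (hl : ∀ (v : ℕ → X) (x : X) (l : ℝ), (∀ n, v n ∈ D) → Tendsto v atTop (𝓝 x) →
      Tendsto (fun n => F (v n)) atTop (𝓝 l) → x ∈ D ∧ F x ≤ l)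
    (ht : ∀ x ∈ D, ∃ y ∈ D, y ≠ x ∧ F y + g y x ≤ F x) : False := by
  have gnn : ∀ x y, 0 ≤ g x y := fun x y => by
    by_cases h : x = y
    · rw [h, hg0]
    · exact (hgpos x y h).le
  let r : X × ℝ → X × ℝ → Prop := fun p q =>
    q.1 ∈ D ∧ q.2 ≤ p.2 ∧ F q.1 + q.2 + g q.1 p.1 ≤ F p.1 + p.2
  let S : X → X → Prop := fun x y =>
    y ∈ D ∧ ∀ ε : ℝ, 0 < ε → Relation.ReflTransGen r (x, ε) (y, 0)
  have shift : ∀ (t : ℝ) (p q : X × ℝ), Relation.ReflTransGen r p q →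
      Relation.ReflTransGen r (p.1, p.2 + t) (q.1, q.2 + t) := by
    intro t p q h
    refine Relation.ReflTransGen.lift (fun p : X × ℝ => (p.1, p.2 + t)) ?_ _ _ h
    rintro a b ⟨h1, h2, h3⟩
    exact ⟨h1, by simpa using h2, by simp only; linarith⟩
  have Srefl : ∀ x ∈ D, S x x := fun x hx =>
    ⟨hx, fun ε hε => Relation.ReflTransGen.single ⟨hx, hε.le, by simp only [hg0]; linarith⟩⟩
  have Strans : ∀ x y z, S x y → S y z → S x z := by
    intro x y z h1 h2
    refine ⟨h2.1, fun ε hε => ?_⟩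
    have a := shift (ε / 2) _ _ (h1.2 (ε / 2) (by linarith))
    simp only [zero_add, add_halves] at a
    exact a.trans (h2.2 _ (by linarith))
  have ex : ∀ x ∈ D, ∀ δ : ℝ, 0 < δ → ∃ y, S x y ∧ ∀ z, S x z → F y ≤ F z + δ := by
    intro x hx δ hδ
    have hne : (F '' {y | S x y}).Nonempty := ⟨_, x, Srefl x hx, rfl⟩
    have hb : BddBelow (F '' {y | S x y}) := ⟨c, by rintro _ ⟨y, hy, rfl⟩; exact hc y hy.1⟩
    obtain ⟨_, ⟨y, hy, rfl⟩, hlt⟩ := Real.lt_sInf_add_pos hne hδ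
    refine ⟨y, hy, fun z hz => ?_⟩
    have := csInf_le hb ⟨z, hz, rfl⟩
    linarith
  let σ : ℕ → ℝ := fun n => (1 / 2) ^ n
  have σpos : ∀ n, 0 < σ n := fun n => by positivity
  have σsucc : ∀ n, σ n = σ (n + 1) + σ (n + 1) := fun n => by simp only [σ, pow_succ]; ring
  have σlim : Tendsto σ atTop (𝓝 0) :=
    tendsto_pow_atTop_nhds_zero_of_lt_one (by norm_num) (by norm_num)
  choose! nxt hS hopt using ex
  let xs : ℕ → X := fun n => Nat.rec x0 (fun n x => nxt x (σ n)) n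
  have xsS : ∀ n, xs (n + 1) = nxt (xs n) (σ n) := fun n => rfl
  have xD : ∀ n, xs n ∈ D := by
    intro n
    induction n with
    | zero => exact hx0
    | succ n ih => exact (hS _ ih _ (σpos n)).1
  have xS : ∀ n, S (xs n) (xs (n + 1)) := fun n => hS _ (xD n) _ (σpos n)
  have xSm : ∀ n m, n ≤ m → S (xs n) (xs m) := by
    intro n m h
    induction m, h using Nat.le_induction with
    | base => exact Srefl _ (xD n)
    | succ m _ ih => exact Strans _ _ _ ih (xS m)
  obtain ⟨u, K, hK, uK, hu⟩ := aux_interp r (fun n => (xs n, σ n)) (by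
    intro n
    apply aux_path
    · exact ⟨xD (n + 1), le_rfl, by simp only [hg0]; linarith⟩
    · have := shift (σ (n + 1)) _ _ ((xS n).2 _ (σpos (n + 1)))
      simp only [← σsucc, zero_add] at this
      exact this)
  have K0 : ∀ k, k ≤ K k := fun k => hK.id_le k
  have santi : Antitone fun k => (u k).2 := antitone_nat_of_succ_le fun k => (hu k).2.1
  have spos : ∀ k, 0 ≤ (u k).2 := fun k => by
    have h1 := santi (K0 k)
    simp only [uK] at h1
    exact (σpos k).le.trans h1
  have uD : ∀ k, (u (k + 1)).1 ∈ D := fun k => (hu k).1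
  have slim : Tendsto (fun k => (u k).2) atTop (𝓝 0) := by
    have h1 := tendsto_atTop_ciInf santi ⟨0, by rintro _ ⟨k, rfl⟩; exact spos k⟩
    have h2 := h1.comp hK.tendsto_atTop
    have h3 : ((fun k => (u k).2) ∘ K) = σ := by funext n; simp [uK]
    rw [h3] at h2
    rwa [tendsto_nhds_unique h2 σlim] at h1
  let P : ℕ → ℝ := fun k => F (u (k + 1)).1 + (u (k + 1)).2
  have Pstep : ∀ k, g (u (k + 2)).1 (u (k + 1)).1 ≤ P k - P (k + 1) := fun k => by
    have := (hu (k + 1)).2.2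
    simp only [P]
    linarith
  have Panti : Antitone P := antitone_nat_of_succ_le fun k => by
    have := Pstep k
    have := gnn (u (k + 2)).1 (u (k + 1)).1
    linarith
  have Pc : ∀ k, c ≤ P k := fun k => by
    have := hc _ (uD k)
    have := spos (k + 1)
    simp only [P]; linarith
  have Pb : BddBelow (Set.range P) := ⟨c, by rintro _ ⟨k, rfl⟩; exact Pc k⟩
  have Plim := tendsto_atTop_ciInf Panti Pb
  have PL : ∀ k, (⨅ i, P i) ≤ P k := fun k => ciInf_le Pb k
  set L := ⨅ i, P i with hLdef
  have Flim : Tendsto (fun k => F (u (k + 1)).1) atTop (𝓝 L) := by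
    have := Plim.sub (slim.comp (tendsto_add_atTop_nat 1))
    simpa [P, Function.comp_def] using this
  obtain ⟨φ, hφ, x, hx⟩ := hsemi (fun k => (u (k + 1)).1) (by
    refine summable_of_sum_range_le (c := P 0 - c) (fun _ => gnn _ _) fun n => ?_
    have h1 : ∑ i ∈ Finset.range n, g (u (i + 1 + 1)).1 (u (i + 1)).1 ≤
        ∑ i ∈ Finset.range n, (P i - P (i + 1)) := Finset.sum_le_sum fun i _ => Pstep i
    rw [Finset.sum_range_sub'] at h1
    have := Pc n
    linarith)
  obtain ⟨hxD, hxL⟩ := hl _ x L (fun n => uD (φ n)) hx (Flim.comp hφ.tendsto_atTop)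
  obtain ⟨y, hyD, hyx, hy⟩ := ht x hxD
  have glim : Tendsto (fun j => g y (u (φ j + 1)).1) atTop (𝓝 (g y x)) :=
    ((hgcont y).tendsto x).comp hx
  have yS : ∀ n, S (xs n) y := by
    intro n
    refine ⟨hyD, fun ε hε => ?_⟩
    obtain ⟨m, hm, hnm⟩ := ((σlim.eventually (gt_mem_nhds (show (0:ℝ) < ε / 4 by linarith))).and
      (eventually_ge_atTop n)).exists
    obtain ⟨j, hj, hjK⟩ := ((glim.eventually
      (gt_mem_nhds (show g y x < g y x + ε / 4 by linarith))).and
      (eventually_ge_atTop (K m))).exists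
    have a := shift (ε / 2) _ _ ((xSm n m hnm).2 (ε / 2) (by linarith))
    simp only [zero_add, add_halves] at a
    have b : ∀ k, K m ≤ k → Relation.ReflTransGen r (u (K m)) (u k) := by
      intro k hk
      induction k, hk using Nat.le_induction with
      | base => exact .refl
      | succ k _ ih => exact ih.tail (hu k)
    have b' := shift (ε / 2 - σ m) _ _ (b (φ j + 1) (by have := hφ.id_le j; simp at this; omega))
    rw [uK] at b'
    simp only [add_sub_cancel] at b'
    refine (a.trans b').tail ⟨hyD, ?_, ?_⟩
    · have := spos (φ j + 1)
      simp only; linarith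
    · have := PL (φ j)
      simp only [P] at this
      simp only
      linarith
  have hle : L ≤ F y := by
    have h1 : Tendsto (fun n => F (xs (n + 1))) atTop (𝓝 L) := by
      have ht2 : Tendsto (fun n => K (n + 1) - 1) atTop atTop :=
        tendsto_atTop_mono (fun n => by have := K0 (n + 1); show n ≤ _; omega) tendsto_id
      refine (Flim.comp ht2).congr fun n => ?_
      have : K (n + 1) - 1 + 1 = K (n + 1) := by have := K0 (n + 1); omega
      simp [this, uK]
    have h2 : Tendsto (fun n => F y + σ n) atTop (𝓝 (F y + 0)) := tendsto_const_nhds.add σlim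
    rw [add_zero] at h2
    exact le_of_tendsto_of_tendsto' h1 h2 fun n => hopt _ (xD n) _ (σpos n) y (yS n)
  have := hgpos y x hyx
  linarith

/-- Takahashi-type theorem in a Σ_g-semicomplete premetric space.
The condition g(y,x) ≤ f(x) − f(y) is rendered as f(y) + g(y,x) ≤ f(x). -/
theorem stmt_10 {X : Type*} [TopologicalSpace X] [FirstCountableTopology X]
    (g : X → X → ℝ)
    (hg0 : ∀ x : X, g x x = 0) (hgpos : ∀ x y : X, x ≠ y → 0 < g x y)
    (hgcont : ∀ x : X, Continuous (g x))
    (hsemi : ∀ u : ℕ → X, Summable (fun i => g (u (i + 1)) (u i)) →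
      ∃ φ : ℕ → ℕ, StrictMono φ ∧ ∃ x : X, Tendsto (u ∘ φ) atTop (𝓝 x))
    (f : X → EReal)
    (hproper : ∃ x : X, f x ≠ ⊤)
    (hlsc : LowerSemicontinuous f)
    (hbdd : ∃ c : ℝ, ∀ x : X, (c : EReal) ≤ f x)
    (htak : ∀ x : X, (⨅ z : X, f z) < f x →
      ∃ y : X, y ≠ x ∧ f y + (g y x : EReal) ≤ f x) :
    ∃ v : X, f v = ⨅ z : X, f z := by
  by_contra hcon
  push Not at hcon
  obtain ⟨x0, hx0⟩ := hproper
  obtain ⟨c, hc⟩ := hbdd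
  have hbot : ∀ x, f x ≠ ⊥ := fun x h => by
    have := hc x
    rw [h] at this
    simp at this
  have hco : ∀ x, f x ≠ ⊤ → ((f x).toReal : EReal) = f x := fun x hx =>
    EReal.coe_toReal hx (hbot x)
  refine aux_main g hg0 hgpos hgcont hsemi {x | f x ≠ ⊤} (fun x => (f x).toReal) x0 hx0 c
    ?_ ?_ ?_
  · intro x hx
    have := hc x
    rw [← hco x hx] at this
    exact_mod_cast this
  · intro v x l hv hvx hvl
    have key : f x ≤ (l : EReal) := by
      by_contra hlt
      push Not at hlt
      obtain ⟨d, hd1, hd2⟩ := EReal.lt_iff_exists_real_btwn.1 hlt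
      have e1 := hvx.eventually (hlsc x d hd2)
      have e2 := hvl.eventually (gt_mem_nhds (EReal.coe_lt_coe_iff.1 hd1))
      obtain ⟨n, h1, h2⟩ := (e1.and e2).exists
      rw [← hco _ (hv n)] at h1
      exact lt_asymm h2 (EReal.coe_lt_coe_iff.1 h1)
    have hxt : f x ≠ ⊤ := fun h => by
      rw [h] at key
      simp at key
    refine ⟨hxt, ?_⟩
    rw [← hco x hxt] at key
    exact_mod_cast key
  · intro x hx
    obtain ⟨y, hyx, hy⟩ := htak x (lt_of_le_of_ne (iInf_le f x) (hcon x).symm)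
    have hyt : f y ≠ ⊤ := fun h => by
      rw [h, EReal.top_add_coe] at hy
      exact hx (top_le_iff.1 hy)
    refine ⟨y, hyt, hyx, ?_⟩
    rw [← hco x hx, ← hco y hyt] at hy
    exact_mod_cast hy
end

section
/- Let (X, τ, g) be a first countable premetric space. Suppose that for every proper, lower semicontinuous and bounded below function f : X → ℝ ∪ {+∞} satisfying the Takahashi condition (for each x ∈ X with f(x) > inf_X f there exists y ∈ X, y ≠ x, such that g(y, x) ≤ f(x) − f(y)), there exists v ∈ X with f(v) = inf_X f. Then (X, τ, g) is Σ_g-semicomplete. -/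
open Filter Topology

/-- Theorem (Takahashi inverse). If in a first countable premetric space every
proper, lower semicontinuous, bounded below f satisfying the Takahashi condition attains
its infimum, then the space is Σ_g-semicomplete. -/
theorem stmt_11 {X : Type*} [TopologicalSpace X] [FirstCountableTopology X]
    (g : X → X → ℝ)
    (hg0 : ∀ x : X, g x x = 0) (hgpos : ∀ x y : X, x ≠ y → 0 < g x y)
    (hgcont : ∀ x : X, Continuous (g x))
    (hyp : ∀ f : X → EReal, (∃ x : X, f x ≠ ⊤) → LowerSemicontinuous f →
      (∃ c : ℝ, ∀ x : X, (c : EReal) ≤ f x) →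
      (∀ x : X, (⨅ z : X, f z) < f x →
        ∃ y : X, y ≠ x ∧ f y + (g y x : EReal) ≤ f x) →
      ∃ v : X, f v = ⨅ z : X, f z) :
    -- Σ_g-semicompleteness
    ∀ u : ℕ → X, Summable (fun i => g (u (i + 1)) (u i)) →
      ∃ φ : ℕ → ℕ, StrictMono φ ∧ ∃ x : X, Tendsto (u ∘ φ) atTop (𝓝 x) := by
  classical
  intro u hu
  by_contra hno
  have hT1 : ∀ a x : X, a ≠ x → ∀ᶠ z in 𝓝 x, a ≠ z := by
    intro a x hax
    have h1 : ∀ᶠ z in 𝓝 x, 0 < g a z :=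
      (hgcont a).continuousAt.eventually (lt_mem_nhds (hgpos a x hax))
    filter_upwards [h1] with z hz haz
    rw [← haz, hg0] at hz
    exact lt_irrefl _ hz
  have hncl : ∀ x : X, ∃ N : ℕ, ∀ᶠ z in 𝓝 x, ∀ n, N ≤ n → u n ≠ z := by
    intro x
    by_contra hx
    push Not at hx
    apply hno
    have hc : MapClusterPt x atTop u := by
      rw [mapClusterPt_iff_frequently]
      intro s hs
      rw [frequently_atTop]
      intro N
      by_contra hcon
      push Not at hcon
      refine hx N ?_
      filter_upwards [hs] with z hz hex
      obtain ⟨n, hn, hnz⟩ := hex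
      exact hcon n hn (hnz ▸ hz)
    obtain ⟨φ, h1, h2⟩ := MapClusterPt.tendsto_subseq hc
    exact ⟨φ, h1, x, h2⟩
  have hgnn : ∀ x y, 0 ≤ g x y := by
    intro x y
    by_cases h : x = y
    · rw [h, hg0]
    · exact (hgpos x y h).le
  set a : ℕ → ℝ := fun i => g (u (i + 1)) (u i) with ha
  set T : ℕ → ℝ := fun n => ∑' i, a (i + n) with hT
  have hTs : ∀ n, T n = a n + T (n + 1) := by
    intro n
    have h := ((summable_nat_add_iff n).2 hu).tsum_eq_zero_add
    simp only [hT]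
    rw [h]
    simp only [zero_add]
    congr 1
    apply tsum_congr
    intro i
    congr 1
    omega
  have hTanti : Antitone T := antitone_nat_of_succ_le (fun n => by
    have h1 := hTs n
    have h2 : 0 ≤ a n := hgnn _ _
    linarith)
  have hTnn : ∀ n, 0 ≤ T n := fun n => tsum_nonneg (fun i => hgnn _ _)
  have hTlim : Tendsto T atTop (𝓝 0) := tendsto_sum_nat_add a
  set f : X → EReal := fun x => ⨅ n : ℕ, ⨅ _ : u n = x, (T n : EReal) with hf
  have hfle : ∀ n, f (u n) ≤ (T n : EReal) := fun n =>
    iInf₂_le (f := fun k (_ : u k = u n) => (T k : EReal)) n rfl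
  have hf0 : ∀ x, (0 : EReal) ≤ f x := fun x =>
    le_iInf₂ (fun n _ => by exact_mod_cast hTnn n)
  have hlast : ∀ x, (∃ n, u n = x) →
      ∃ m, u m = x ∧ u (m + 1) ≠ x ∧ f x = (T m : EReal) := by
    rintro x ⟨n, hn⟩
    obtain ⟨N, hN⟩ := hncl x
    have hN' := hN.self_of_nhds
    have hnN : n ≤ N := by
      by_contra h
      exact hN' n (by omega) hn
    have h1 : u (Nat.findGreatest (fun k => u k = x) N) = x :=
      Nat.findGreatest_spec (P := fun k => u k = x) hnN hn
    have h2 : ∀ k, u k = x → k ≤ Nat.findGreatest (fun k => u k = x) N := by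
      intro k hk
      apply Nat.le_findGreatest _ hk
      by_contra h
      exact hN' k (by omega) hk
    refine ⟨_, h1, fun h => ?_, le_antisymm
      (iInf₂_le (f := fun k (_ : u k = x) => (T k : EReal)) _ h1) (le_iInf₂ fun k hk => ?_)⟩
    · have := h2 _ h
      omega
    · exact_mod_cast hTanti (h2 k hk)
  have hinf : (⨅ z, f z) = 0 := by
    apply le_antisymm _ (le_iInf hf0)
    have h1 : Tendsto (fun n => (T n : EReal)) atTop (𝓝 ((0 : ℝ) : EReal)) :=
      (continuous_coe_real_ereal.tendsto 0).comp hTlim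
    exact ge_of_tendsto' h1 (fun n => (iInf_le f (u n)).trans (hfle n))
  obtain ⟨v, hv⟩ := hyp f ⟨u 0, ne_top_of_le_ne_top (EReal.coe_ne_top _) (hfle 0)⟩
    (by
      intro x c hc
      obtain ⟨N, hN⟩ := hncl x
      have h2 : ∀ᶠ z in 𝓝 x, ∀ n ∈ Finset.range N, u n ≠ x → u n ≠ z := by
        rw [Filter.eventually_all_finset]
        intro n _
        by_cases h : u n = x
        · exact Eventually.of_forall (fun z h' => absurd h h')
        · filter_upwards [hT1 _ _ h] with z hz _ using hz
      filter_upwards [hN, h2] with z hz1 hz2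
      refine lt_of_lt_of_le hc (le_iInf₂ fun n hn =>
        iInf₂_le (f := fun k (_ : u k = x) => (T k : EReal)) n ?_)
      by_contra hnx
      by_cases hnN : N ≤ n
      · exact hz1 n hnN hn
      · exact hz2 n (Finset.mem_range.2 (by omega)) hnx hn)
    ⟨0, fun x => by simpa using hf0 x⟩
    (by
      intro x _
      by_cases hx : ∃ n, u n = x
      · obtain ⟨m, hm, hm1, hfm⟩ := hlast x hx
        refine ⟨u (m + 1), hm1, ?_⟩
        rw [hfm, hTs m, EReal.coe_add, add_comm]
        have : a m = g (u (m + 1)) x := by simp only [ha]; rw [hm]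
        rw [this]
        exact add_le_add le_rfl (hfle (m + 1))
      · refine ⟨u 0, fun h => hx ⟨0, h⟩, ?_⟩
        have : f x = ⊤ := by
          simp only [hf, iInf_eq_top]
          intro n hn
          exact absurd ⟨n, hn⟩ hx
        rw [this]
        exact le_top)
  rw [hinf] at hv
  have hvr : ∃ n, u n = v := by
    by_contra hx
    have : f v = ⊤ := by
      simp only [hf, iInf_eq_top]
      intro n hn
      exact absurd ⟨n, hn⟩ hx
    rw [this] at hv
    exact absurd hv (by simp)
  obtain ⟨m, hm, hm1, hfm⟩ := hlast v hvr
  rw [hv] at hfm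
  have h0 : T m = 0 := by exact_mod_cast hfm.symm
  have h1 : 0 < a m := hgpos _ _ (by rw [hm]; exact hm1)
  have h2 := hTs m
  have h3 := hTnn (m + 1)
  linarith
end

section
/- (Ekeland-type theorem in premetric spaces) Let (X, τ, g) be a Σ_g-semicomplete premetric space and let f : X → ℝ ∪ {+∞} be proper, lower semicontinuous and bounded below. Then for every ε > 0 there exists v ∈ X such that f(v) ≤ f(x) + ε g(x, v) for all x ∈ X. -/
open Filter Topology

/-- Ekeland-type theorem in a Σ_g-semicomplete premetric space: for every
ε > 0 there exists v with f(v) ≤ f(x) + ε g(x, v) for all x. -/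
theorem stmt_12 {X : Type*} [TopologicalSpace X] [FirstCountableTopology X]
    (g : X → X → ℝ)
    (hg0 : ∀ x : X, g x x = 0) (hgpos : ∀ x y : X, x ≠ y → 0 < g x y)
    (hgcont : ∀ x : X, Continuous (g x))
    (hsemi : ∀ u : ℕ → X, Summable (fun i => g (u (i + 1)) (u i)) →
      ∃ φ : ℕ → ℕ, StrictMono φ ∧ ∃ x : X, Tendsto (u ∘ φ) atTop (𝓝 x))
    (f : X → EReal)
    (hproper : ∃ x : X, f x ≠ ⊤)
    (hlsc : LowerSemicontinuous f)
    (hbdd : ∃ c : ℝ, ∀ x : X, (c : EReal) ≤ f x) :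
    ∀ ε : ℝ, 0 < ε → ∃ v : X, ∀ x : X, f v ≤ f x + ((ε * g x v : ℝ) : EReal) := by
  intro ε hε
  by_contra! hcon
  obtain ⟨c, hc⟩ := hbdd
  obtain ⟨x0, hx0⟩ := hproper
  have hgn : ∀ x y, 0 ≤ g x y := by
    intro x y
    by_cases h : x = y
    · rw [h, hg0]
    · exact (hgpos x y h).le
  have hbot : ∀ x, f x ≠ ⊥ := fun x h => by
    have := hc x
    rw [h] at this
    exact absurd this (by simp)
  set F : X → ℝ := fun x => (f x).toReal with hF
  have hco : ∀ x, f x ≠ ⊤ → f x = (F x : EReal) := fun x h =>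
    (EReal.coe_toReal h (hbot x)).symm
  have hFc : ∀ x, f x ≠ ⊤ → c ≤ F x := fun x h => by
    have := hc x
    rw [hco x h] at this
    exact_mod_cast this
  have hex : ∀ v, f v ≠ ⊤ → ∃ x, f x ≠ ⊤ ∧ F x + ε * g x v < F v := by
    intro v hv
    obtain ⟨x, hx⟩ := hcon v
    have hxt : f x ≠ ⊤ := by
      intro h
      rw [h, EReal.top_add_coe] at hx
      exact not_top_lt hx
    refine ⟨x, hxt, ?_⟩
    rw [hco x hxt, hco v hv] at hx
    exact_mod_cast hx
  have hstep : ∀ v : {x // f x ≠ ⊤}, ∃ w : {x // f x ≠ ⊤}, F w + ε * g w v < F v ∧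
      ∀ y, f y ≠ ⊤ → F y + ε * g y v < F v → F w ≤ (F v + F y) / 2 := by
    rintro ⟨v, hv⟩
    obtain ⟨x, hx, hxv⟩ := hex v hv
    let S : Set ℝ := Set.image F {y | f y ≠ ⊤ ∧ F y + ε * g y v < F v}
    have hSb : BddBelow S := ⟨c, by rintro _ ⟨y, hy, rfl⟩; exact hFc y hy.1⟩
    have hxS : F x ∈ S := ⟨x, ⟨hx, hxv⟩, rfl⟩
    have h1 : sInf S ≤ F x := csInf_le hSb hxS
    have h2 : 0 ≤ ε * g x v := mul_nonneg hε.le (hgn _ _)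
    obtain ⟨_, ⟨w, hw, rfl⟩, hlt⟩ := exists_lt_of_csInf_lt ⟨_, hxS⟩
      (show sInf S < (F v + sInf S) / 2 by linarith)
    refine ⟨⟨w, hw.1⟩, hw.2, fun y hy hyv => ?_⟩
    have h3 : sInf S ≤ F y := csInf_le hSb ⟨y, ⟨hy, hyv⟩, rfl⟩
    show F w ≤ (F v + F y) / 2
    linarith
  choose T hT1 hT2 using hstep
  let U : ℕ → {x // f x ≠ ⊤} := fun n => T^[n] ⟨x0, hx0⟩
  have hU : ∀ n, U (n + 1) = T (U n) := fun n => Function.iterate_succ_apply' _ _ _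
  let a : ℕ → ℝ := fun n => F (U n)
  have ha1 : ∀ n, a (n + 1) + ε * g (U (n + 1)) (U n) < a n := fun n => by
    have := hT1 (U n)
    rw [← hU] at this
    exact this
  have ha2 : ∀ n y, f y ≠ ⊤ → F y + ε * g y (U n) < a n → a (n + 1) ≤ (a n + F y) / 2 :=
    fun n y hy h => by
      have := hT2 (U n) y hy h
      rw [← hU] at this
      exact this
  have hanti : Antitone a := antitone_nat_of_succ_le fun n => by
    have := ha1 n
    have := mul_nonneg hε.le (hgn (U (n + 1)) (U n))
    linarith
  have hab : ∀ n, c ≤ a n := fun n => hFc _ (U n).2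
  have hbd : BddBelow (Set.range a) := ⟨c, by rintro _ ⟨n, rfl⟩; exact hab n⟩
  have hlim := tendsto_atTop_ciInf hanti hbd
  have hLle : ∀ n, (⨅ i, a i) ≤ a n := fun n => ciInf_le hbd n
  set L := ⨅ i, a i
  have hsum : Summable (fun i => g (U (i + 1)) (U i)) := by
    refine summable_of_sum_range_le (c := (a 0 - c) / ε) (fun _ => hgn _ _) fun n => ?_
    rw [le_div_iff₀ hε]
    have : (∑ i ∈ Finset.range n, g (U (i + 1)) (U i)) * ε ≤ a 0 - a n := by
      induction n with
      | zero => simp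
      | succ k ih =>
        rw [Finset.sum_range_succ]
        have := ha1 k
        linarith
    linarith [hab n]
  obtain ⟨φ, hφ, x, hx⟩ := hsemi (fun n => (U n : X)) hsum
  have haφ : Tendsto (fun n => a (φ n)) atTop (𝓝 L) := hlim.comp hφ.tendsto_atTop
  have haφ1 : Tendsto (fun n => a (φ n + 1)) atTop (𝓝 L) :=
    ((tendsto_add_atTop_iff_nat 1).2 hlim).comp hφ.tendsto_atTop
  have hfx : f x ≤ (L : EReal) := by
    by_contra! h
    obtain ⟨r, hr1, hr2⟩ := EReal.lt_iff_exists_real_btwn.1 h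
    have hr1 : L < r := by exact_mod_cast hr1
    have e1 := hx.eventually (hlsc x r hr2)
    have e2 := haφ.eventually (gt_mem_nhds hr1)
    obtain ⟨n, h1, h2⟩ := (e1.and e2).exists
    simp only [Function.comp] at h1
    rw [hco _ (U (φ n)).2] at h1
    have h1 : r < a (φ n) := by exact_mod_cast h1
    linarith
  have hxt : f x ≠ ⊤ := ne_top_of_le_ne_top (EReal.coe_ne_top L) hfx
  have hFx : F x ≤ L := by
    rw [hco x hxt] at hfx
    exact_mod_cast hfx
  obtain ⟨y, hy, hyx⟩ := hex x hxt
  have hgy : Tendsto (fun n => F y + ε * g y (U (φ n))) atTop (𝓝 (F y + ε * g y x)) :=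
    ((((hgcont y).tendsto x).comp hx).const_mul ε).const_add (F y)
  have e := hgy.eventually (gt_mem_nhds hyx)
  have hfin : L ≤ (L + F y) / 2 := by
    refine le_of_tendsto_of_tendsto haφ1 ((haφ.add_const (F y)).div_const 2) ?_
    filter_upwards [e] with n hn
    exact ha2 _ y hy (by linarith [hLle (φ n)])
  have := mul_nonneg hε.le (hgn y x)
  linarith
end

section
/- Let (X, τ, g) be a first countable premetric space. Suppose that for every ε > 0 and every proper, lower semicontinuous and bounded below function f : X → ℝ ∪ {+∞} there exists v ∈ X such that f(v) ≤ f(x) + ε g(x, v) for all x ∈ X. Then (X, τ, g) is Σ_g-semicomplete. -/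
open Filter Topology

/-- Theorem (Ekeland inverse). If in a first countable premetric space the
Ekeland-type conclusion holds for every ε > 0 and every proper, lower semicontinuous,
bounded below f, then the space is Σ_g-semicomplete. -/
theorem stmt_13 {X : Type*} [TopologicalSpace X] [FirstCountableTopology X]
    (g : X → X → ℝ)
    (hg0 : ∀ x : X, g x x = 0) (hgpos : ∀ x y : X, x ≠ y → 0 < g x y)
    (hgcont : ∀ x : X, Continuous (g x))
    (hyp : ∀ ε : ℝ, 0 < ε → ∀ f : X → EReal, (∃ x : X, f x ≠ ⊤) →
      LowerSemicontinuous f → (∃ c : ℝ, ∀ x : X, (c : EReal) ≤ f x) →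
      ∃ v : X, ∀ x : X, f v ≤ f x + ((ε * g x v : ℝ) : EReal)) :
    -- Σ_g-semicompleteness
    ∀ u : ℕ → X, Summable (fun i => g (u (i + 1)) (u i)) →
      ∃ φ : ℕ → ℕ, StrictMono φ ∧ ∃ x : X, Tendsto (u ∘ φ) atTop (𝓝 x) := by
  classical
  intro u hu
  by_contra hno
  have hnn : ∀ x y, 0 ≤ g x y := by
    intro x y
    by_cases h : x = y
    · rw [h, hg0]
    · exact (hgpos x y h).le
  have hT1 : T1Space X := by
    refine ⟨fun x => ?_⟩
    have : ({x} : Set X) = (g x) ⁻¹' {0} := by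
      ext y
      simp only [Set.mem_singleton_iff, Set.mem_preimage]
      constructor
      · rintro rfl
        exact hg0 _
      · intro h
        by_contra hne
        exact absurd h (hgpos x y (Ne.symm hne)).ne'
    rw [this]
    exact isClosed_singleton.preimage (hgcont x)
  have hloc : ∀ x : X, ∃ U ∈ 𝓝 x, ∃ N : ℕ, ∀ n ≥ N, u n ∉ U := by
    intro x
    by_contra hcon
    push Not at hcon
    have hc : MapClusterPt x atTop u := by
      rw [mapClusterPt_iff_frequently]
      intro s hs
      rw [frequently_atTop]
      intro a
      obtain ⟨n, hn, hn'⟩ := hcon s hs a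
      exact ⟨n, hn, hn'⟩
    obtain ⟨ψ, hψ, ht⟩ := TopologicalSpace.FirstCountableTopology.tendsto_subseq hc
    exact hno ⟨ψ, hψ, x, ht⟩
  set S : ℝ := ∑' i, g (u (i + 1)) (u i) with hS
  obtain ⟨T, hT⟩ : ∃ T : ℕ → ℝ,
      ∀ n, T n = S - ∑ i ∈ Finset.range n, g (u (i + 1)) (u i) := ⟨_, fun _ => rfl⟩
  have hT0 : ∀ n, 0 ≤ T n := by
    intro n
    rw [hT, sub_nonneg]
    exact hu.sum_le_tsum _ (fun i _ => hnn _ _)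
  have hTs : ∀ n, T n = T (n + 1) + g (u (n + 1)) (u n) := by
    intro n
    rw [hT, hT, Finset.sum_range_succ]
    ring
  have hTanti : Antitone T := by
    refine antitone_nat_of_succ_le fun n => ?_
    linarith [hTs n, hnn (u (n + 1)) (u n)]
  obtain ⟨f, hf⟩ : ∃ f : X → EReal,
      ∀ x, f x = ⨅ n : ℕ, if u n = x then ((T n : ℝ) : EReal) else ⊤ := ⟨_, fun _ => rfl⟩
  have hfle : ∀ n, f (u n) ≤ ((T n : ℝ) : EReal) := by
    intro n
    rw [hf]
    exact (iInf_le _ n).trans (by simp)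
  have hftop : ∀ x, (∀ n, u n ≠ x) → f x = ⊤ := by
    intro x hx
    rw [hf]
    simp [hx]
  have hlsc : LowerSemicontinuous f := by
    intro x c hc
    obtain ⟨U, hU, N, hN⟩ := hloc x
    have hF : (((Finset.range N).image u : Finset X) : Set X) \ {x} |>.Finite :=
      (Finset.finite_toSet _).subset Set.diff_subset
    have hV : ((((Finset.range N).image u : Finset X) : Set X) \ {x})ᶜ ∈ 𝓝 x :=
      hF.isClosed.isOpen_compl.mem_nhds (by simp)
    filter_upwards [hU, hV] with y hy hy'
    by_cases hyx : y = x
    · rwa [hyx]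
    · rw [hftop y]
      · exact hc.trans_le le_top
      · intro n hn
        subst hn
        by_cases hnN : N ≤ n
        · exact hN n hnN hy
        · apply hy'
          refine ⟨?_, hyx⟩
          simp only [Finset.coe_image, Set.mem_image, Finset.mem_coe, Finset.mem_range]
          exact ⟨n, not_le.mp hnN, rfl⟩
  have hbd : ∃ c : ℝ, ∀ x : X, (c : EReal) ≤ f x := by
    refine ⟨0, fun x => ?_⟩
    rw [hf]
    refine le_iInf fun n => ?_
    split_ifs
    · exact EReal.coe_le_coe_iff.mpr (hT0 n)
    · exact le_top
  obtain ⟨v, hv⟩ := hyp (1 / 2) (by norm_num) f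
    ⟨u 0, ((hfle 0).trans_lt (EReal.coe_lt_top _)).ne⟩ hlsc hbd
  have hvr : ∃ n, u n = v := by
    by_contra hcon
    push Not at hcon
    have h1 := hv (u 0)
    rw [hftop v hcon] at h1
    have h2 := h1.trans (add_le_add_left (hfle 0) _)
    rw [← EReal.coe_add] at h2
    exact absurd h2 (not_le.mpr (EReal.coe_lt_top _))
  obtain ⟨n, hn, hlast⟩ : ∃ n, u n = v ∧ ∀ m, u m = v → m ≤ n := by
    obtain ⟨U, hU, N, hN⟩ := hloc v
    have hb : ∀ m, u m = v → m ≤ N := by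
      intro m hm
      by_contra hlt
      exact hN m (not_le.mp hlt).le (hm ▸ mem_of_mem_nhds hU)
    obtain ⟨k, hk⟩ := hvr
    exact ⟨Nat.findGreatest (fun m => u m = v) N,
      Nat.findGreatest_spec (P := fun m => u m = v) (hb k hk) hk,
      fun m hm => Nat.le_findGreatest (hb m hm) hm⟩
  have hfv : ((T n : ℝ) : EReal) ≤ f v := by
    rw [hf]
    refine le_iInf fun m => ?_
    split_ifs with h
    · exact EReal.coe_le_coe_iff.mpr (hTanti (hlast m h))
    · exact le_top
  have hne : u (n + 1) ≠ v := fun h => by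
    have := hlast _ h
    omega
  have h3 := (hfv.trans (hv (u (n + 1)))).trans (add_le_add_left (hfle (n + 1)) _)
  rw [← EReal.coe_add, EReal.coe_le_coe_iff] at h3
  have h4 := hTs n
  rw [hn] at h4
  linarith [hgpos _ _ hne]
end

section
/- Let (X, d) be a complete metric space and let S : X ⇒ X satisfy condition (∗̂₁) at x₀ ∈ X. Then at least one of the following holds: (a) there is an S-orbit of finite length starting at x₀ and ending at a point outside dom S = {x : S(x) ≠ ∅}; (b) there is an S-orbit of infinite length starting at x₀. -/
open Filter Topology

/-- Theorem (loev-cmp). In a complete metric space, if S satisfies (∗̂₁) at x₀,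
then either (a) some S-orbit of finite length starting at x₀ ends outside dom S
(a finite orbit whose last point has empty value, or an infinite orbit of finite length
converging to a point with empty value), or (b) some S-orbit starting at x₀ has
infinite length. -/
theorem stmt_14 {X : Type*} [MetricSpace X] [CompleteSpace X]
    (S : X → Set X) (x₀ : X)
    (hS0 : ∀ x : X, x ∉ S x)
    (hS1 : ∀ u : ℕ → X, u 0 = x₀ → (∀ n, u (n + 1) ∈ S (u n)) →
      ∀ x : X, Tendsto u atTop (𝓝 x) → ∀ y ∈ S x,
      ∃ φ : ℕ → ℕ, StrictMono φ ∧ ∃ v : ℕ → X,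
        (∀ k, v k ∈ S (u (φ k))) ∧ Tendsto v atTop (𝓝 y)) :
    -- (a) an S-orbit of finite length starting at x₀ and ending outside dom S
    ((∃ (n : ℕ) (u : ℕ → X), u 0 = x₀ ∧ (∀ i < n, u (i + 1) ∈ S (u i)) ∧ S (u n) = ∅) ∨
     (∃ (u : ℕ → X) (x : X), u 0 = x₀ ∧ (∀ i, u (i + 1) ∈ S (u i)) ∧
        Summable (fun i => dist (u (i + 1)) (u i)) ∧
        Tendsto u atTop (𝓝 x) ∧ S x = ∅)) ∨
    -- (b) an S-orbit of infinite length starting at x₀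
    (∃ u : ℕ → X, u 0 = x₀ ∧ (∀ i, u (i + 1) ∈ S (u i)) ∧
      ¬ Summable (fun i => dist (u (i + 1)) (u i))) := by
  classical
  have hg : ∀ x : X, ∃ y : X, (S x).Nonempty →
      y ∈ S x ∧ ∀ z ∈ S x, min 1 (dist z x) ≤ 2 * dist y x := by
    intro x
    by_cases h : (S x).Nonempty
    · obtain ⟨z0, hz0⟩ := h
      have hpos : 0 < min 1 (dist z0 x) := by
        apply lt_min one_pos
        rw [dist_pos]
        rintro rfl
        exact hS0 _ hz0
      have hbd : BddAbove ((fun z => min 1 (dist z x)) '' S x) := by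
        refine ⟨1, ?_⟩
        rintro _ ⟨z, _, rfl⟩
        exact min_le_left _ _
      have hle : ∀ z ∈ S x, min 1 (dist z x) ≤ sSup ((fun z => min 1 (dist z x)) '' S x) :=
        fun z hz => le_csSup hbd ⟨z, hz, rfl⟩
      have h0 := hle z0 hz0
      obtain ⟨_, ⟨y, hy, rfl⟩, hlt⟩ := exists_lt_of_lt_csSup
        (s := (fun z => min 1 (dist z x)) '' S x)
        (b := sSup ((fun z => min 1 (dist z x)) '' S x) / 2) ⟨_, z0, hz0, rfl⟩ (by linarith)
      refine ⟨y, fun _ => ⟨hy, fun z hz => ?_⟩⟩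
      have h1 := hle z hz
      have h2 : min 1 (dist y x) ≤ dist y x := min_le_right _ _
      simp only at hlt
      linarith
    · exact ⟨x, fun h' => absurd h' h⟩
  choose g hg using hg
  have hstep : ∀ n, g^[n+1] x₀ = g (g^[n] x₀) := fun n => Function.iterate_succ_apply' g n x₀
  by_cases hne : ∃ n, S (g^[n] x₀) = ∅
  · left; left
    refine ⟨Nat.find hne, fun n => g^[n] x₀, rfl, fun i hi => ?_, Nat.find_spec hne⟩
    have := Nat.find_min hne hi
    simp only [hstep]
    exact (hg _ (Set.nonempty_iff_ne_empty.2 this)).1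
  · push Not at hne
    have horb : ∀ i, g^[i+1] x₀ ∈ S (g^[i] x₀) := by
      intro i
      rw [hstep]
      exact (hg _ (hne i)).1
    by_cases hsum : Summable (fun i => dist (g^[i+1] x₀) (g^[i] x₀))
    · left; right
      have hc : CauchySeq (fun n => g^[n] x₀) := by
        apply cauchySeq_of_summable_dist
        simpa only [dist_comm, Nat.succ_eq_add_one] using hsum
      obtain ⟨x, hx⟩ := cauchySeq_tendsto_of_complete hc
      refine ⟨fun n => g^[n] x₀, x, rfl, horb, hsum, hx, ?_⟩
      by_contra hSx
      obtain ⟨y, hy⟩ := Set.nonempty_iff_ne_empty.2 hSx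
      obtain ⟨φ, hφ, v, hv, hvy⟩ := hS1 (fun n => g^[n] x₀) rfl horb x hx y hy
      have t1 : Tendsto (fun k => min 1 (dist (v k) (g^[φ k] x₀))) atTop
          (𝓝 (min 1 (dist y x))) :=
        tendsto_const_nhds.min (hvy.dist (hx.comp hφ.tendsto_atTop))
      have t2 : Tendsto (fun k => 2 * dist (g^[φ k + 1] x₀) (g^[φ k] x₀)) atTop (𝓝 (2 * 0)) :=
        (hsum.tendsto_atTop_zero.comp hφ.tendsto_atTop).const_mul 2
      have hle := le_of_tendsto_of_tendsto' t1 t2 (fun k => by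
        rw [hstep]
        exact (hg _ (hne _)).2 _ (hv k))
      have hpos : 0 < min 1 (dist y x) := by
        apply lt_min one_pos
        rw [dist_pos]
        rintro rfl
        exact hS0 _ hy
      linarith
    · right
      exact ⟨fun n => g^[n] x₀, rfl, horb, hsum⟩
end

section
/- Let (X, d) be a complete metric space, let S : X ⇒ X be idempotent (S(S(x)) ⊆ S(x) for all x ∈ X) with closed values, and let x₀ ∈ X. Then at least one of the following holds: (a) there is an S-orbit of finite length starting at x₀ and ending at a point x ∈ X such that S(x) ⊆ {x}; (b) there is an S-orbit of infinite length starting at x₀. -/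
open Filter Topology

theorem greedy_step {X : Type*} [MetricSpace X] (A : Set X) (x : X) (hA : A.Nonempty) :
    ∃ z ∈ A, ∀ y ∈ A, min 1 (dist y x) ≤ 2 * dist z x := by
  set f : X → ℝ := fun z => min 1 (dist z x) with hf
  have hb : BddAbove (f '' A) := ⟨1, by rintro _ ⟨z, _, rfl⟩; exact min_le_left _ _⟩
  have hle : ∀ y ∈ A, f y ≤ sSup (f '' A) := fun y hy => le_csSup hb ⟨y, hy, rfl⟩
  by_cases h : 0 < sSup (f '' A)
  · obtain ⟨_, ⟨z, hz, rfl⟩, hlt⟩ :=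
      exists_lt_of_lt_csSup (hA.image f) (half_lt_self h)
    refine ⟨z, hz, fun y hy => ?_⟩
    have h1 := hle y hy
    have h2 : f z ≤ dist z x := min_le_right _ _
    change f y ≤ _
    linarith
  · obtain ⟨z, hz⟩ := hA
    refine ⟨z, hz, fun y hy => ?_⟩
    have h1 := hle y hy
    have h2 : 0 ≤ dist z x := dist_nonneg
    change f y ≤ _
    linarith

/-- Theorem (loev-mon). In a complete metric space, if S is idempotent with
closed values, then either (a) some S-orbit of finite length starting at x₀ ends at a
point x with S(x) ⊆ {x}, or (b) some S-orbit starting at x₀ has infinite length. -/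
theorem stmt_15 {X : Type*} [MetricSpace X] [CompleteSpace X]
    (S : X → Set X)
    (hidem : ∀ x : X, ∀ y ∈ S x, S y ⊆ S x)
    (hclosed : ∀ x : X, IsClosed (S x))
    (x₀ : X) :
    -- (a) a finite-length S-orbit starting at x₀ and ending at x with S(x) ⊆ {x}
    ((∃ (n : ℕ) (u : ℕ → X), u 0 = x₀ ∧ (∀ i < n, u (i + 1) ∈ S (u i)) ∧ S (u n) ⊆ {u n}) ∨
     (∃ (u : ℕ → X) (x : X), u 0 = x₀ ∧ (∀ i, u (i + 1) ∈ S (u i)) ∧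
        Summable (fun i => dist (u (i + 1)) (u i)) ∧
        Tendsto u atTop (𝓝 x) ∧ S x ⊆ {x})) ∨
    -- (b) an S-orbit of infinite length starting at x₀
    (∃ u : ℕ → X, u 0 = x₀ ∧ (∀ i, u (i + 1) ∈ S (u i)) ∧
      ¬ Summable (fun i => dist (u (i + 1)) (u i))) := by
  have hg : ∀ x, ∃ z, (S x).Nonempty → z ∈ S x ∧ ∀ y ∈ S x, min 1 (dist y x) ≤ 2 * dist z x := by
    intro x
    by_cases h : (S x).Nonempty
    · obtain ⟨z, h1, h2⟩ := greedy_step (S x) x h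
      exact ⟨z, fun _ => ⟨h1, h2⟩⟩
    · exact ⟨x, fun h' => absurd h' h⟩
  choose g hg using hg
  set u : ℕ → X := fun n => g^[n] x₀ with hu
  have hu1 : ∀ n, u (n + 1) = g (u n) := fun n => Function.iterate_succ_apply' g n x₀
  have hu0 : u 0 = x₀ := rfl
  clear_value u
  classical
  by_cases he : ∃ n, ¬ (S (u n)).Nonempty
  · left; left
    refine ⟨Nat.find he, u, hu0, fun i hi => ?_, ?_⟩
    · have := Nat.find_min he hi
      rw [hu1]
      exact (hg _ (not_not.mp this)).1
    · rw [Set.not_nonempty_iff_eq_empty.mp (Nat.find_spec he)]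
      exact Set.empty_subset _
  push Not at he
  have horb : ∀ i, u (i + 1) ∈ S (u i) := fun i => by rw [hu1]; exact (hg _ (he i)).1
  by_cases hs : Summable (fun i => dist (u (i + 1)) (u i))
  swap
  · exact Or.inr ⟨u, hu0, horb, hs⟩
  left; right
  have hc : CauchySeq u := cauchySeq_of_summable_dist (by simpa [dist_comm] using hs)
  obtain ⟨x, hx⟩ := cauchySeq_tendsto_of_complete hc
  refine ⟨u, x, hu0, horb, hs, hx, fun y hy => ?_⟩
  have hmem : ∀ i k, u (i + k + 1) ∈ S (u i) := by
    intro i k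
    induction k with
    | zero => exact horb i
    | succ k ih => exact hidem _ _ ih (horb _)
  have hxS : ∀ i, x ∈ S (u i) := fun i => by
    refine (hclosed (u i)).mem_of_tendsto ((tendsto_add_atTop_iff_nat (i + 1)).mpr hx)
      (Eventually.of_forall fun k => ?_)
    have := hmem i k
    rwa [show i + k + 1 = k + (i + 1) by omega] at this
  have hbd : ∀ i, min 1 (dist y (u i)) ≤ 2 * dist (u (i + 1)) (u i) := fun i => by
    rw [hu1]
    exact (hg _ (he i)).2 y (hidem _ _ (hxS i) hy)
  have l1 : Tendsto (fun i => min 1 (dist y (u i))) atTop (𝓝 (min 1 (dist y x))) :=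
    tendsto_const_nhds.min (tendsto_const_nhds.dist hx)
  have l2 := hs.tendsto_atTop_zero.const_mul 2
  have h3 := le_of_tendsto_of_tendsto' l1 l2 hbd
  rw [mul_zero] at h3
  have h4 : dist y x ≤ 0 := by
    rcases min_le_iff.mp h3 with h | h
    · norm_num at h
    · exact h
  exact dist_le_zero.mp h4
end

section
/- (Oettli–Théra theorem) Let (X, d) be a complete metric space and let p : X × X → ℝ ∪ {+∞} be a generalized pseudometric, i.e. p(x,x) = 0 for all x ∈ X and p(x,z) ≤ p(x,y) + p(y,z) for all x, y, z ∈ X, which is lower semicontinuous in its second argument. Let x₀ ∈ X satisfy inf_{x∈X} p(x₀, x) > −∞. Let A := {x ∈ X : p(x₀, x) + d(x₀, x) ≤ 0} and let Ψ ⊆ X be such that for each x ∈ A \ Ψ there exists y ∈ X with y ≠ x and p(x, y) + d(x, y) ≤ 0. Then A ∩ Ψ ≠ ∅. -/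
open Filter Topology

/-- Oettli–Théra theorem. p : X × X → ℝ ∪ {+∞} is a generalized
pseudometric (p(x,x) = 0, triangle inequality), lower semicontinuous in its second
argument, with inf_x p(x₀, x) > −∞. -/
theorem stmt_16 {X : Type*} [MetricSpace X] [CompleteSpace X]
    (p : X → X → EReal)
    (hbot : ∀ x y : X, p x y ≠ ⊥)
    (hrefl : ∀ x : X, p x x = 0)
    (htri : ∀ x y z : X, p x z ≤ p x y + p y z)
    (hlsc : ∀ x : X, LowerSemicontinuous (p x))
    (x₀ : X)
    (hbdd : ∃ c : ℝ, ∀ x : X, (c : EReal) ≤ p x₀ x)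
    (Ψ : Set X)
    (hΨ : ∀ x ∈ {z : X | p x₀ z + (dist x₀ z : ℝ) ≤ 0} \ Ψ,
      ∃ y : X, y ≠ x ∧ p x y + (dist x y : ℝ) ≤ 0) :
    ({z : X | p x₀ z + (dist x₀ z : ℝ) ≤ 0} ∩ Ψ).Nonempty := by
  have hR : ∀ x y : X, p x y + (dist x y : ℝ) ≤ 0 ↔ p x y ≤ ((-dist x y : ℝ) : EReal) := by
    intro x y
    have h1 := hbot x y
    induction hp : p x y with
    | bot => exact absurd hp h1
    | top => simp
    | coe a =>
      norm_cast
      constructor <;> intro h <;> linarith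
  simp only [hR] at hΨ ⊢
  obtain ⟨c, hc⟩ := hbdd
  have htrans : ∀ x y z : X, p x y ≤ ((-dist x y : ℝ) : EReal) →
      p y z ≤ ((-dist y z : ℝ) : EReal) → p x z ≤ ((-dist x z : ℝ) : EReal) := by
    intro x y z h1 h2
    refine (htri x y z).trans ((add_le_add h1 h2).trans ?_)
    norm_cast
    linarith [dist_triangle x y z]
  have hcoe : ∀ z, p x₀ z ≤ ((-dist x₀ z : ℝ) : EReal) → p x₀ z = ((p x₀ z).toReal : EReal) := by
    intro z hz
    refine (EReal.coe_toReal ?_ (hbot _ _)).symm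
    intro h
    rw [h] at hz
    exact absurd (top_le_iff.mp hz) (EReal.coe_ne_top _)
  set f : X → ℝ := fun z => (p x₀ z).toReal with hf
  have hfc : ∀ z, p x₀ z ≤ ((-dist x₀ z : ℝ) : EReal) → c ≤ f z := by
    intro z hz
    have := hc z
    rw [hcoe z hz] at this
    exact_mod_cast this
  have hdec : ∀ y z, p x₀ y ≤ ((-dist x₀ y : ℝ) : EReal) → p y z ≤ ((-dist y z : ℝ) : EReal) →
      dist y z ≤ f y - f z := by
    intro y z hy hz
    have h := (htri x₀ y z).trans (add_le_add le_rfl hz)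
    rw [hcoe y hy, hcoe z (htrans _ _ _ hy hz)] at h
    have h' : f z ≤ f y + -dist y z := by exact_mod_cast h
    linarith
  have hrefl' : ∀ x, p x x ≤ ((-dist x x : ℝ) : EReal) := by
    intro x
    simp [hrefl]
  have hstep : ∀ (n : ℕ) (x : {z : X // p x₀ z ≤ ((-dist x₀ z : ℝ) : EReal)}),
      ∃ y : {z : X // p x₀ z ≤ ((-dist x₀ z : ℝ) : EReal)},
        p x y ≤ ((-dist (x : X) y : ℝ) : EReal) ∧
        ∀ w, p x w ≤ ((-dist (x : X) w : ℝ) : EReal) → f y ≤ f w + (1 / 2 : ℝ) ^ n := by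
    rintro n ⟨x, hx⟩
    have hne : (f '' {w | p x w ≤ ((-dist x w : ℝ) : EReal)}).Nonempty :=
      ⟨f x, x, hrefl' x, rfl⟩
    have hb : BddBelow (f '' {w | p x w ≤ ((-dist x w : ℝ) : EReal)}) := by
      refine ⟨c, ?_⟩
      rintro _ ⟨w, hw, rfl⟩
      exact hfc w (htrans _ _ _ hx hw)
    have hpos : (0 : ℝ) < (1 / 2 : ℝ) ^ n := by positivity
    obtain ⟨_, ⟨y, hy, rfl⟩, hlt⟩ := Real.lt_sInf_add_pos hne hpos
    refine ⟨⟨y, htrans _ _ _ hx hy⟩, hy, fun w hw => ?_⟩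
    have := csInf_le hb ⟨w, hw, rfl⟩
    show f y ≤ _
    linarith
  choose g hg1 hg2 using hstep
  obtain ⟨u, hu0, hu⟩ : ∃ u : ℕ → {z : X // p x₀ z ≤ ((-dist x₀ z : ℝ) : EReal)},
      (u 0).1 = x₀ ∧ ∀ n, u (n + 1) = g n (u n) :=
    ⟨fun n => Nat.rec ⟨x₀, hrefl' x₀⟩ (fun n x => g n x) n, rfl, fun n => rfl⟩
  have hmono : ∀ n m : ℕ, n ≤ m → p (u n).1 (u m).1 ≤ ((-dist (u n).1 (u m).1 : ℝ) : EReal) := by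
    intro n m hnm
    induction m, hnm using Nat.le_induction with
    | base => exact hrefl' _
    | succ m _ ih => exact htrans _ _ _ ih (by rw [hu]; exact hg1 m (u m))
  have hdiam : ∀ (n : ℕ) (w : X), p (u (n + 1)).1 w ≤ ((-dist (u (n + 1)).1 w : ℝ) : EReal) →
      dist (u (n + 1)).1 w ≤ (1 / 2 : ℝ) ^ n := by
    intro n w hw
    have h1 := hdec _ _ (u (n + 1)).2 hw
    have h2 := hg2 n (u n) w (htrans _ _ _ (hmono n (n + 1) (Nat.le_succ n)) hw)
    rw [← hu] at h2
    linarith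
  have hlim0 : Tendsto (fun n : ℕ => (1 / 2 : ℝ) ^ n) atTop (𝓝 0) :=
    tendsto_pow_atTop_nhds_zero_of_lt_one (by norm_num) (by norm_num)
  have hcau : CauchySeq (fun n => (u (n + 1)).1) := by
    refine cauchySeq_of_le_tendsto_0' (fun n : ℕ => (1 / 2 : ℝ) ^ n) ?_ hlim0
    intro n m hnm
    exact hdiam n _ (hmono (n + 1) (m + 1) (by omega))
  obtain ⟨x, hx⟩ := cauchySeq_tendsto_of_complete hcau
  have hxS : ∀ n : ℕ, p (u n).1 x ≤ ((-dist (u n).1 x : ℝ) : EReal) := by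
    intro n
    by_contra hcon
    rw [not_le] at hcon
    obtain ⟨r, hr1, hr2⟩ := EReal.lt_iff_exists_real_btwn.mp hcon
    have e1 := hx.eventually (hlsc (u n).1 x _ hr2)
    have hr1' : -dist (u n).1 x < r := by exact_mod_cast hr1
    have e2 := (tendsto_const_nhds.dist hx).neg.eventually (gt_mem_nhds hr1')
    obtain ⟨k, ⟨h1, h2⟩, h3⟩ := ((e1.and e2).and (eventually_ge_atTop n)).exists
    have h4 := h1.trans_le (hmono n (k + 1) (by omega))
    have h5 : r < -dist (u n).1 (u (k + 1)).1 := by exact_mod_cast h4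
    linarith
  have hxA := hxS 0
  rw [hu0] at hxA
  refine ⟨x, hxA, ?_⟩
  by_contra hxΨ
  obtain ⟨y, hyx, hy⟩ := hΨ x ⟨hxA, hxΨ⟩
  refine hyx (tendsto_nhds_unique ?_ hx)
  rw [tendsto_iff_dist_tendsto_zero]
  exact squeeze_zero (fun _ => dist_nonneg)
    (fun n => hdiam n y (htrans _ _ _ (hxS (n + 1)) hy)) hlim0
end

section
/- (Fabián–Preiss theorem) Let (X, d) be a complete metric space, I an index set, {p_i}_{i∈I} pseudometrics on X that are continuous as functions from X × X to ℝ, and {f_i}_{i∈I} lower semicontinuous functions from X to ℝ ∪ {+∞}. Suppose there exists i₀ ∈ I with p_{i₀} = d. Let x₀ ∈ ⋂_{i∈I} dom f_i be fixed and set Φ := {x ∈ X : p_i(x₀, x) ≤ f_i(x₀) − f_i(x) for all i ∈ I}. Assume that for every x ∈ Φ with f_{i₀}(x) > 0 there exists y ≠ x such that p_i(x, y) ≤ f_i(x) − f_i(y) for all i ∈ I. Then there exists x̄ ∈ Φ with f_{i₀}(x̄) ≤ 0. -/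
open Filter Topology

/-- Fabián–Preiss theorem. The inequalities p_i(x₀,x) ≤ f_i(x₀) − f_i(x)
are rendered as f_i(x) + p_i(x₀,x) ≤ f_i(x₀) in the extended reals. -/
theorem stmt_17 {X : Type*} [MetricSpace X] [CompleteSpace X] {I : Type*}
    (p : I → X → X → ℝ)
    (hp0 : ∀ (i : I) (x : X), p i x x = 0)
    (hpsymm : ∀ (i : I) (x y : X), p i x y = p i y x)
    (hpnn : ∀ (i : I) (x y : X), 0 ≤ p i x y)
    (hptri : ∀ (i : I) (x y z : X), p i x z ≤ p i x y + p i y z)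
    (hpcont : ∀ i : I, Continuous (fun q : X × X => p i q.1 q.2))
    (f : I → X → EReal)
    (hbot : ∀ (i : I) (x : X), f i x ≠ ⊥)
    (hlsc : ∀ i : I, LowerSemicontinuous (f i))
    (i₀ : I) (hi₀ : ∀ x y : X, p i₀ x y = dist x y)
    (x₀ : X) (hx₀ : ∀ i : I, f i x₀ ≠ ⊤)
    (hnext : ∀ x ∈ {z : X | ∀ i : I, f i z + (p i x₀ z : ℝ) ≤ f i x₀},
      0 < f i₀ x → ∃ y : X, y ≠ x ∧ ∀ i : I, f i y + (p i x y : ℝ) ≤ f i x) :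
    ∃ xbar ∈ {z : X | ∀ i : I, f i z + (p i x₀ z : ℝ) ≤ f i x₀}, f i₀ xbar ≤ 0 := by
  classical
  by_contra hcon
  have hpos : ∀ z, (∀ i : I, f i z + (p i x₀ z : ℝ) ≤ f i x₀) → 0 < f i₀ z := by
    intro z hz
    by_contra h
    exact hcon ⟨z, hz, not_lt.1 h⟩
  -- the relation
  let R : X → X → Prop := fun x y => ∀ i : I, f i y + (p i x y : ℝ) ≤ f i x
  have hRrefl : ∀ x, R x x := by
    intro x i
    simp [hp0]
  have hRtrans : ∀ x y z, R x y → R y z → R x z := by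
    intro x y z hxy hyz i
    calc f i z + ((p i x z : ℝ) : EReal)
        ≤ f i z + ((p i y z + p i x y : ℝ) : EReal) := by
          gcongr
          have := hptri i x y z
          exact_mod_cast (by linarith : p i x z ≤ p i y z + p i x y)
      _ = (f i z + (p i y z : ℝ)) + (p i x y : ℝ) := by
          rw [EReal.coe_add, add_assoc]
      _ ≤ f i y + (p i x y : ℝ) := by
          gcongr
          exact hyz i
      _ ≤ f i x := hxy i
  have hRclosed : ∀ x, IsClosed {y | R x y} := by
    intro x
    have : {y | R x y} = ⋂ i, {y | f i y + ((p i x y : ℝ) : EReal) ≤ f i x} := by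
      ext y; simp [R]
    rw [this]
    refine isClosed_iInter fun i => ?_
    have hc : Continuous (fun y => ((p i x y : ℝ) : EReal)) :=
      continuous_coe_real_ereal.comp
        ((hpcont i).comp (Continuous.prodMk continuous_const continuous_id))
    have hl : LowerSemicontinuous (fun y => f i y + ((p i x y : ℝ) : EReal)) := by
      refine LowerSemicontinuous.add' (hlsc i) hc.lowerSemicontinuous ?_
      intro y
      exact EReal.continuousAt_add (Or.inr (EReal.coe_ne_bot _)) (Or.inr (EReal.coe_ne_top _))
    exact hl.isClosed_preimage (f i x)
  let g : X → ℝ := fun x => (f i₀ x).toReal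
  have hfin : ∀ z, R x₀ z → ((g z : ℝ) : EReal) = f i₀ z := by
    intro z hz
    refine EReal.coe_toReal ?_ (hbot _ _)
    intro htop
    have := hz i₀
    rw [htop, EReal.top_add_coe] at this
    exact hx₀ i₀ (top_le_iff.1 this)
  have hg0 : ∀ z, R x₀ z → 0 ≤ g z := by
    intro z hz
    have := hpos z hz
    rw [← hfin z hz] at this
    exact le_of_lt (by exact_mod_cast this)
  have hgd : ∀ x y, R x₀ x → R x y → g y + dist x y ≤ g x := by
    intro x y hx hxy
    have := hxy i₀
    rw [← hfin x hx, ← hfin y (hRtrans _ _ _ hx hxy), hi₀] at this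
    exact_mod_cast this
  have hstep : ∀ (n : ℕ) (x : {x // R x₀ x}), ∃ y : {x // R x₀ x}, R x y ∧
      ∀ z, R x z → g y ≤ g z + 1 / ((n : ℝ) + 1) := by
    intro n x
    have hbdd : BddBelow (g '' {z | R x z}) := by
      refine ⟨0, ?_⟩
      rintro _ ⟨z, hz, rfl⟩
      exact hg0 z (hRtrans _ _ _ x.2 hz)
    have hne : (g '' {z | R x z}).Nonempty := ⟨_, x.1, hRrefl _, rfl⟩
    have hlt : sInf (g '' {z | R x z}) < sInf (g '' {z | R x z}) + 1 / ((n : ℝ) + 1) :=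
      lt_add_of_pos_right _ (by positivity)
    obtain ⟨_, ⟨y, hy, rfl⟩, hlt2⟩ := exists_lt_of_csInf_lt hne hlt
    refine ⟨⟨y, hRtrans _ _ _ x.2 hy⟩, hy, fun z hz => ?_⟩
    have := csInf_le hbdd ⟨z, hz, rfl⟩
    simp only
    linarith
  choose nxt hnxt1 hnxt2 using hstep
  let u : ℕ → {x // R x₀ x} := fun n => Nat.rec ⟨x₀, hRrefl x₀⟩ (fun k x => nxt k x) n
  have hu : ∀ n, u (n + 1) = nxt n (u n) := fun n => rfl
  have hmono : ∀ n m : ℕ, n ≤ m → R (u n).1 (u m).1 := by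
    intro n m h
    induction m, h using Nat.le_induction with
    | base => exact hRrefl _
    | succ m _ ih => exact hRtrans _ _ _ ih (by rw [hu]; exact hnxt1 _ _)
  have hclose : ∀ (n : ℕ) (y : X), R (u (n + 1)).1 y → dist (u (n + 1) : X) y ≤ 1 / ((n : ℝ) + 1) := by
    intro n y hy
    have h1 := hgd _ _ (u (n + 1)).2 hy
    have h2 := hnxt2 n (u n) y (hRtrans _ _ _ (hmono n (n + 1) (Nat.le_succ n)) hy)
    rw [← hu] at h2
    linarith
  have hlim0 : Tendsto (fun n : ℕ => 1 / ((n : ℝ) + 1)) atTop (𝓝 0) :=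
    tendsto_one_div_add_atTop_nhds_zero_nat
  have hcau : CauchySeq (fun n => (u (n + 1) : X)) := by
    refine cauchySeq_of_le_tendsto_0' (fun n : ℕ => 1 / ((n : ℝ) + 1)) ?_ hlim0
    intro n m h
    exact hclose n _ (hmono (n + 1) (m + 1) (by omega))
  obtain ⟨a, ha⟩ := cauchySeq_tendsto_of_complete hcau
  have haR : ∀ n : ℕ, R (u n).1 a := by
    intro n
    refine (hRclosed (u n).1).mem_of_tendsto ha ?_
    filter_upwards [eventually_ge_atTop n] with m hm
    exact hmono n (m + 1) (by omega)
  have hx0a : R x₀ a := haR 0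
  obtain ⟨y, hya, hy⟩ := hnext a hx0a (hpos a hx0a)
  apply hya
  refine tendsto_nhds_unique ?_ ha
  rw [tendsto_iff_dist_tendsto_zero]
  exact squeeze_zero (fun _ => dist_nonneg)
    (fun n => hclose n y (hRtrans _ _ _ (haR (n + 1)) hy)) hlim0
end

section
/- Let (X, d) be a complete metric space with d bounded, and let Y = ⋂_{n=1}^∞ Uₙ be a nonempty G_δ subset of X, where each Uₙ is open and Uₙ ≠ X. Set Fₙ := X \ Uₙ, φₙ(x) := 1/dist(x, Fₙ) for x ∈ Uₙ, and define for x, y ∈ Y: g(x,y) := d(x,y) + ∑_{n=1}^∞ 2^{-n} |φₙ(x) − φₙ(y)| / (1 + |φₙ(x) − φₙ(y)|). Then g is a premetric on Y (with the subspace topology induced by d), and (Y, τ_d, g) is Σ_g-complete: every sequence {xᵢ} in Y with ∑_{i=0}^∞ g(x_{i+1}, xᵢ) < ∞ converges to a point of Y. -/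
open Filter Topology

/-- (Section 5.) For a nonempty G_δ set Y = ⋂ Uₙ in a complete metric space
with bounded metric, the function g defined via the φₙ's is a premetric on Y (subspace
topology), and (Y, τ_d, g) is Σ_g-complete: each sequence in Y of finite g-length
converges to a point of Y. -/
theorem stmt_18 {X : Type*} [MetricSpace X] [CompleteSpace X]
    (hbd : ∃ C : ℝ, ∀ x y : X, dist x y ≤ C)
    (U : ℕ → Set X) (hUopen : ∀ n, IsOpen (U n)) (hUne : ∀ n, U n ≠ Set.univ)
    (Y : Set X) (hY : Y = ⋂ n, U n) (hYne : Y.Nonempty)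
    (φ : ℕ → X → ℝ) (hφ : ∀ (n : ℕ) (x : X), φ n x = 1 / Metric.infDist x (U n)ᶜ)
    (g : X → X → ℝ)
    (hg : ∀ x y : X, g x y = dist x y +
      ∑' n : ℕ, (1 / 2 : ℝ) ^ (n + 1) *
        (|φ n x - φ n y| / (1 + |φ n x - φ n y|))) :
    -- (P1): g is zero on the diagonal and positive off the diagonal of Y
    (∀ x ∈ Y, g x x = 0) ∧
    (∀ x ∈ Y, ∀ y ∈ Y, x ≠ y → 0 < g x y) ∧
    -- (P2): g(x, ·) is continuous on Y for the subspace topology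
    (∀ x ∈ Y, ContinuousOn (g x) Y) ∧
    -- Σ_g-completeness: every Σ_g-Cauchy sequence in Y converges to a point of Y
    (∀ u : ℕ → X, (∀ i, u i ∈ Y) →
      Summable (fun i => g (u (i + 1)) (u i)) →
      ∃ x ∈ Y, Tendsto u atTop (𝓝 x)) := by
  have hs : Summable (fun n : ℕ => (1 / 2 : ℝ) ^ (n + 1)) :=
    (summable_nat_add_iff 1).2 summable_geometric_two
  have ht0 : ∀ (x y : X) (n : ℕ), 0 ≤ (1 / 2 : ℝ) ^ (n + 1) *
        (|φ n x - φ n y| / (1 + |φ n x - φ n y|)) := fun x y n => by positivity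
  have ht1 : ∀ (x y : X) (n : ℕ), (1 / 2 : ℝ) ^ (n + 1) *
        (|φ n x - φ n y| / (1 + |φ n x - φ n y|)) ≤ (1 / 2 : ℝ) ^ (n + 1) := fun x y n => by
    have h : |φ n x - φ n y| / (1 + |φ n x - φ n y|) ≤ 1 := by
      rw [div_le_one (by positivity)]
      linarith
    exact mul_le_of_le_one_right (by positivity) h
  have hts : ∀ x y : X, Summable (fun n : ℕ => (1 / 2 : ℝ) ^ (n + 1) *
        (|φ n x - φ n y| / (1 + |φ n x - φ n y|))) := fun x y =>
    Summable.of_nonneg_of_le (ht0 x y) (ht1 x y) hs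
  have hdg : ∀ x y : X, dist x y ≤ g x y := fun x y => by
    rw [hg]
    exact le_add_of_nonneg_right (tsum_nonneg (ht0 x y))
  have htg : ∀ (x y : X) (n : ℕ), (1 / 2 : ℝ) ^ (n + 1) *
        (|φ n x - φ n y| / (1 + |φ n x - φ n y|)) ≤ g x y := fun x y n => by
    rw [hg]
    have := (hts x y).le_tsum n (fun j _ => ht0 x y j)
    linarith [dist_nonneg (x := x) (y := y)]
  have hmem : ∀ (n : ℕ) (x : X), x ∈ U n ↔ Metric.infDist x (U n)ᶜ ≠ 0 := fun n x => by
    have h := (hUopen n).isClosed_compl.mem_iff_infDist_zero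
      (Set.nonempty_compl.2 (hUne n)) (x := x)
    rw [ne_eq, ← h, Set.mem_compl_iff, not_not]
  refine ⟨fun x _ => by simp [hg], fun x _ y _ hxy => (dist_pos.2 hxy).trans_le (hdg x y), ?_, ?_⟩
  · intro x _
    have hgx : g x = fun y => dist x y +
      ∑' n : ℕ, (1 / 2 : ℝ) ^ (n + 1) *
        (|φ n x - φ n y| / (1 + |φ n x - φ n y|)) := funext (hg x)
    rw [hgx]
    refine ContinuousOn.add (by fun_prop) ?_
    refine continuousOn_tsum ?_ hs ?_
    · intro n
      have hc : ContinuousOn (φ n) Y := by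
        have : φ n = fun x => 1 / Metric.infDist x (U n)ᶜ := funext (hφ n)
        rw [this]
        refine ContinuousOn.div continuousOn_const
          (Metric.continuous_infDist_pt _).continuousOn ?_
        intro y hy
        rw [hY] at hy
        exact (hmem n y).1 (Set.mem_iInter.1 hy n)
      have ha : ContinuousOn (fun y => |φ n x - φ n y|) Y := (continuousOn_const.sub hc).abs
      refine continuousOn_const.mul (ha.div (continuousOn_const.add ha) ?_)
      intro y _
      positivity
    · intro n y _
      rw [Real.norm_of_nonneg (ht0 x y n)]
      exact ht1 x y n
  · intro u hu hsum
    have hd : Summable (fun i => dist (u i) (u (i + 1))) :=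
      Summable.of_nonneg_of_le (fun _ => dist_nonneg)
        (fun i => by rw [dist_comm]; exact hdg _ _) hsum
    obtain ⟨x, hx⟩ := cauchySeq_tendsto_of_complete (cauchySeq_of_summable_dist hd)
    refine ⟨x, ?_, hx⟩
    rw [hY, Set.mem_iInter]
    intro n
    rw [hmem]
    have hb : Summable (fun i => |φ n (u (i+1)) - φ n (u i)| /
        (1 + |φ n (u (i+1)) - φ n (u i)|)) := by
      have h1 : Summable (fun i => (1 / 2 : ℝ) ^ (n + 1) * (|φ n (u (i+1)) - φ n (u i)| /
        (1 + |φ n (u (i+1)) - φ n (u i)|))) :=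
        Summable.of_nonneg_of_le (fun i => ht0 _ _ n) (fun i => htg _ _ n) hsum
      exact (summable_mul_left_iff (by positivity)).1 h1
    have ha : Summable (fun i => dist (φ n (u i)) (φ n (u (i+1)))) := by
      refine Summable.of_norm_bounded_eventually_nat (hb.mul_left 2) ?_
      filter_upwards [hb.tendsto_atTop_zero.eventually_lt_const
        (show (0:ℝ) < 1 / 2 by norm_num)] with i hi
      rw [Real.norm_of_nonneg dist_nonneg, dist_comm, Real.dist_eq]
      generalize hA : |φ n (u (i+1)) - φ n (u i)| = a at hi ⊢
      have ha0 : 0 ≤ a := hA ▸ abs_nonneg _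
      rw [div_lt_iff₀ (by positivity)] at hi
      rw [← mul_div_assoc, le_div_iff₀ (by positivity)]
      nlinarith
    obtain ⟨L, hL⟩ := cauchySeq_tendsto_of_complete (cauchySeq_of_summable_dist ha)
    have hi := ((Metric.continuous_infDist_pt (U n)ᶜ).tendsto x).comp hx
    have hm := hi.mul hL
    have h1 : Tendsto (fun _ : ℕ => (1:ℝ)) atTop (𝓝 (Metric.infDist x (U n)ᶜ * L)) := by
      refine hm.congr fun i => ?_
      have hui := hu i
      rw [hY] at hui
      have := (hmem n (u i)).1 (Set.mem_iInter.1 hui n)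
      simp only [Function.comp_apply, hφ]
      field_simp
    have h2 := tendsto_nhds_unique h1 tendsto_const_nhds
    intro h0
    rw [h0, zero_mul] at h2
    exact zero_ne_one h2
end

section
/- Let (X, d) be a complete metric space with d bounded, and let Y = ⋂_{n=1}^∞ Uₙ be a nonempty G_δ subset of X, where each Uₙ is open and Uₙ ≠ X. Set Fₙ := X \ Uₙ, φₙ(x) := 1/dist(x, Fₙ) for x ∈ Uₙ, and define for x, y ∈ Y: g(x,y) := d(x,y) + ∑_{n=1}^∞ 2^{-n} |φₙ(x) − φₙ(y)| / (1 + |φₙ(x) − φₙ(y)|). Let f : Y → ℝ ∪ {+∞} be proper, bounded below and lower semicontinuous. Then for each ε > 0 there exists x_ε ∈ Y such that f(x) + ε g(x_ε, x) ≥ f(x_ε) for all x ∈ Y. -/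
open Filter Topology

/-- An abstract Ekeland principle. -/
theorem ekeland_aux {α : Type*} (p : α → α → ℝ) (hp0 : ∀ x y, 0 ≤ p x y)
    (hpself : ∀ x, p x x = 0)
    (htri : ∀ x y z, p x z ≤ p x y + p y z) (F : α → ℝ) (c : ℝ) (hc : ∀ x, c ≤ F x)
    (a : α) (ε : ℝ) (hε : 0 < ε)
    (H : ∀ x : ℕ → α, Antitone (fun n => F (x n)) →
      (∀ δ > 0, ∃ N, ∀ n ≥ N, p (x N) (x n) < δ) →
      ∃ v, Tendsto (fun n => p (x n) v) atTop (𝓝 0) ∧ ∀ n, F v ≤ F (x n)) :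
    ∃ v, ∀ y, F v ≤ F y + ε * p v y := by
  have hsel : ∀ (n : ℕ) (x : α), ∃ y, F y + ε * p x y ≤ F x ∧
      ∀ z, F z + ε * p x z ≤ F x → F y ≤ F z + 1 / ((n : ℝ) + 1) := by
    intro n x
    have hne : (F '' {y | F y + ε * p x y ≤ F x}).Nonempty :=
      ⟨F x, x, by simp [hpself], rfl⟩
    have hb : BddBelow (F '' {y | F y + ε * p x y ≤ F x}) :=
      ⟨c, by rintro _ ⟨y, _, rfl⟩; exact hc y⟩
    have hpos : (0 : ℝ) < 1 / ((n : ℝ) + 1) := by positivity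
    obtain ⟨_, ⟨y, hy, rfl⟩, hlt⟩ := exists_lt_of_csInf_lt hne
      (lt_add_of_pos_right (sInf (F '' {y | F y + ε * p x y ≤ F x})) hpos)
    refine ⟨y, hy, fun z hz => ?_⟩
    have := csInf_le hb ⟨z, hz, rfl⟩
    linarith
  choose s hs1 hs2 using hsel
  let x : ℕ → α := fun n => Nat.rec a (fun k y => s k y) n
  have hx : ∀ n, x (n + 1) = s n (x n) := fun n => rfl
  have hstep : ∀ n k, F (x (n + k)) + ε * p (x n) (x (n + k)) ≤ F (x n) := by
    intro n k
    induction k with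
    | zero => simp [hpself]
    | succ k ih =>
      have h1 := hs1 (n + k) (x (n + k))
      rw [← hx] at h1
      have h2 := mul_le_mul_of_nonneg_left (htri (x n) (x (n + k)) (x (n + k + 1))) hε.le
      rw [← add_assoc]
      linarith
  have hle : ∀ n m, n ≤ m → F (x m) + ε * p (x n) (x m) ≤ F (x n) := by
    intro n m h
    obtain ⟨k, rfl⟩ := Nat.exists_eq_add_of_le h
    exact hstep n k
  have hanti : Antitone (fun n => F (x n)) := by
    intro n m h
    have h1 := hle n m h
    have h2 := mul_nonneg hε.le (hp0 (x n) (x m))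
    show F (x m) ≤ F (x n)
    linarith
  have hbdd : BddBelow (Set.range fun n => F (x n)) :=
    ⟨c, by rintro _ ⟨n, rfl⟩; exact hc _⟩
  have hcau : ∀ δ > 0, ∃ N, ∀ n ≥ N, p (x N) (x n) < δ := by
    intro δ hδ
    obtain ⟨N, hN⟩ := exists_lt_of_ciInf_lt
      (lt_add_of_pos_right (⨅ n, F (x n)) (mul_pos hε hδ))
    refine ⟨N, fun n hn => ?_⟩
    have h1 := hle N n hn
    have h2 := ciInf_le hbdd n
    have h3 : ε * p (x N) (x n) < ε * δ := by linarith
    exact lt_of_mul_lt_mul_left h3 hε.le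
  obtain ⟨v, hv, hFv⟩ := H x hanti hcau
  have hvS : ∀ n, F v + ε * p (x n) v ≤ F (x n) := by
    intro n
    have hlim : Tendsto (fun m => F (x n) + ε * p (x m) v) atTop (𝓝 (F (x n) + ε * 0)) :=
      (hv.const_mul ε).const_add _
    rw [mul_zero, add_zero] at hlim
    refine ge_of_tendsto hlim ?_
    filter_upwards [eventually_ge_atTop n] with m hm
    have h1 := hle n m hm
    have h2 := mul_le_mul_of_nonneg_left (htri (x n) (x m) v) hε.le
    have h3 := hFv m
    linarith
  refine ⟨v, fun y => ?_⟩
  by_contra! hlt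
  have hy : ∀ n : ℕ, F v ≤ F y + 1 / ((n : ℝ) + 1) := by
    intro n
    have h1 := hvS n
    have h2 := mul_le_mul_of_nonneg_left (htri (x n) v y) hε.le
    have h3 := hs2 n (x n) y (by linarith)
    rw [← hx] at h3
    exact (hFv (n + 1)).trans h3
  have hlim : Tendsto (fun n : ℕ => F y + 1 / ((n : ℝ) + 1)) atTop (𝓝 (F y + 0)) :=
    tendsto_one_div_add_atTop_nhds_zero_nat.const_add _
  have h1 := ge_of_tendsto' hlim hy
  have h2 := mul_nonneg hε.le (hp0 v y)
  linarith

theorem frac_tri (a b c : ℝ) :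
    |a - c| / (1 + |a - c|) ≤ |a - b| / (1 + |a - b|) + |b - c| / (1 + |b - c|) := by
  have h := abs_sub_le a b c
  have hu := abs_nonneg (a - b)
  have hv := abs_nonneg (b - c)
  have hw := abs_nonneg (a - c)
  generalize |a - b| = u at *
  generalize |b - c| = v at *
  generalize |a - c| = w at *
  have h1 : w / (1 + w) ≤ (u + v) / (1 + (u + v)) := by
    rw [div_le_div_iff₀ (by positivity) (by positivity)]
    nlinarith
  have h2 : u / (1 + (u + v)) ≤ u / (1 + u) :=
    div_le_div_of_nonneg_left hu (by positivity) (by linarith)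
  have h3 : v / (1 + (u + v)) ≤ v / (1 + v) :=
    div_le_div_of_nonneg_left hv (by positivity) (by linarith)
  rw [add_div] at h1
  linarith

/-- Corollary (cor:gd). Perturbed minimization on a G_δ subset Y of a
complete metric space: for each ε > 0 there is x_ε ∈ Y with
f(x) + ε g(x_ε, x) ≥ f(x_ε) for all x ∈ Y. -/
theorem stmt_19 {X : Type*} [MetricSpace X] [CompleteSpace X]
    (hbd : ∃ C : ℝ, ∀ x y : X, dist x y ≤ C)
    (U : ℕ → Set X) (hUopen : ∀ n, IsOpen (U n)) (hUne : ∀ n, U n ≠ Set.univ)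
    (Y : Set X) (hY : Y = ⋂ n, U n) (hYne : Y.Nonempty)
    (φ : ℕ → X → ℝ) (hφ : ∀ (n : ℕ) (x : X), φ n x = 1 / Metric.infDist x (U n)ᶜ)
    (g : X → X → ℝ)
    (hg : ∀ x y : X, g x y = dist x y +
      ∑' n : ℕ, (1 / 2 : ℝ) ^ (n + 1) *
        (|φ n x - φ n y| / (1 + |φ n x - φ n y|)))
    (f : X → EReal)
    (hproper : ∃ x ∈ Y, f x ≠ ⊤)
    (hbddbelow : ∃ c : ℝ, ∀ x ∈ Y, (c : EReal) ≤ f x)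
    (hlsc : LowerSemicontinuousOn f Y) :
    ∀ ε : ℝ, 0 < ε → ∃ v ∈ Y, ∀ x ∈ Y, f v ≤ f x + ((ε * g v x : ℝ) : EReal) := by
  intro ε hε
  obtain ⟨c, hc⟩ := hbddbelow
  obtain ⟨a, haY, hatop⟩ := hproper
  -- the terms of the series
  let T : X → X → ℕ → ℝ := fun x y n => (1 / 2 : ℝ) ^ (n + 1) *
        (|φ n x - φ n y| / (1 + |φ n x - φ n y|))
  have hT0 : ∀ x y n, 0 ≤ T x y n := fun x y n => by positivity
  have hTle : ∀ x y n, T x y n ≤ (1 / 2 : ℝ) ^ (n + 1) := by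
    intro x y n
    refine mul_le_of_le_one_right (by positivity) ?_
    rw [div_le_one (by positivity)]
    linarith
  have hgeo : Summable (fun n : ℕ => (1 / 2 : ℝ) ^ (n + 1)) :=
    (summable_nat_add_iff 1).2 summable_geometric_two
  have hTs : ∀ x y, Summable (T x y) := fun x y =>
    Summable.of_nonneg_of_le (hT0 x y) (hTle x y) hgeo
  have hg' : ∀ x y, g x y = dist x y + ∑' n, T x y n := hg
  have hg0 : ∀ x y, 0 ≤ g x y := fun x y => by
    rw [hg']; exact add_nonneg dist_nonneg (tsum_nonneg (hT0 x y))
  have hgself : ∀ x, g x x = 0 := fun x => by rw [hg]; simp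
  have hgtri : ∀ x y z, g x z ≤ g x y + g y z := by
    intro x y z
    have h1 : ∑' n, T x z n ≤ ∑' n, (T x y n + T y z n) := by
      refine (hTs x z).tsum_le_tsum (fun n => ?_) ((hTs x y).add (hTs y z))
      have := mul_le_mul_of_nonneg_left (frac_tri (φ n x) (φ n y) (φ n z))
        (by positivity : (0 : ℝ) ≤ (1 / 2 : ℝ) ^ (n + 1))
      rw [mul_add] at this
      exact this
    rw [(hTs x y).tsum_add (hTs y z)] at h1
    have h2 := dist_triangle x y z
    rw [hg', hg', hg']
    linarith
  have hdg : ∀ x y, dist x y ≤ g x y := fun x y => by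
    rw [hg']; exact le_add_of_nonneg_right (tsum_nonneg (hT0 x y))
  have hTg : ∀ x y n, T x y n ≤ g x y := fun x y n => by
    have h1 := (hTs x y).le_tsum n (fun m _ => hT0 x y m)
    have h2 : 0 ≤ dist x y := dist_nonneg
    rw [hg']; linarith
  -- positivity of the distance
  have hne : ∀ n, ((U n)ᶜ).Nonempty := fun n => Set.nonempty_compl.2 (hUne n)
  have hpos : ∀ n x, x ∈ U n ↔ 0 < Metric.infDist x (U n)ᶜ := by
    intro n x
    rw [← (hUopen n).isClosed_compl.notMem_iff_infDist_pos (hne n)]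
    simp
  have hcoe : ∀ x ∈ Y, f x ≠ ⊤ → ((f x).toReal : EReal) = f x := by
    intro x hx ht
    refine EReal.coe_toReal ht ?_
    intro hb
    have := hc x hx
    rw [hb] at this
    exact absurd this (by simp)
  obtain ⟨v, hv⟩ := ekeland_aux (α := {x : X // x ∈ Y ∧ f x ≠ ⊤})
    (fun x y => g x y) (fun x y => hg0 x y) (fun x => hgself x) (fun x y z => hgtri x y z)
    (fun x => (f x).toReal) c
    (fun x => by
      have := hc x x.2.1
      rw [← hcoe x x.2.1 x.2.2] at this
      exact_mod_cast this) ⟨a, haY, hatop⟩ ε hε (by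
    intro x hanti hcau
    have hcs : CauchySeq (fun n => (x n : X)) := by
      rw [Metric.cauchySeq_iff']
      intro δ hδ
      obtain ⟨N, hN⟩ := hcau δ hδ
      refine ⟨N, fun n hn => ?_⟩
      rw [dist_comm]
      exact (hdg _ _).trans_lt (hN n hn)
    obtain ⟨v, hv⟩ := cauchySeq_tendsto_of_complete hcs
    have hxU : ∀ n k, (x n : X) ∈ U k := by
      intro n k
      exact Set.mem_iInter.1 (hY.subset (x n).2.1) k
    have hlimd : ∀ k, Tendsto (fun n => Metric.infDist (x n : X) (U k)ᶜ) atTop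
        (𝓝 (Metric.infDist v (U k)ᶜ)) := fun k =>
      ((Metric.continuous_infDist_pt _).tendsto v).comp hv
    have hvU : ∀ k, v ∈ U k := by
      intro k
      rw [hpos]
      obtain ⟨N, hN⟩ := hcau ((1 / 2 : ℝ) ^ (k + 1) * (1 / 2)) (by positivity)
      have hM : ∀ n ≥ N, 1 ≤ (φ k (x N) + 1) * Metric.infDist (x n : X) (U k)ᶜ := by
        intro n hn
        have h1 := (hTg (x N) (x n) k).trans_lt (hN n hn)
        have h2 := lt_of_mul_lt_mul_left h1 (by positivity)
        have habs := abs_nonneg (φ k (x N) - φ k (x n))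
        rw [div_lt_iff₀ (by positivity)] at h2
        have h3 : |φ k (x N) - φ k (x n)| < 1 := by linarith
        have h4 := (abs_lt.1 h3).1
        have h5 := (hpos k (x n)).1 (hxU n k)
        have h6 : φ k (x n) * Metric.infDist (x n : X) (U k)ᶜ = 1 := by
          rw [hφ]; field_simp
        rw [← h6]
        exact mul_le_mul_of_nonneg_right (by linarith) h5.le
      have h7 : 1 ≤ (φ k (x N) + 1) * Metric.infDist v (U k)ᶜ := by
        refine ge_of_tendsto ((hlimd k).const_mul _) ?_
        filter_upwards [eventually_ge_atTop N] with n hn using hM n hn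
      rcases (Metric.infDist_nonneg (x := v) (s := (U k)ᶜ)).lt_or_eq with h | h
      · exact h
      · rw [← h] at h7; norm_num at h7
    have hvY : v ∈ Y := by rw [hY]; exact Set.mem_iInter.2 hvU
    have hfv : ∀ n, f v ≤ f (x n) := by
      intro n
      by_contra! hlt
      have hw : Tendsto (fun n => (x n : X)) atTop (𝓝[Y] v) :=
        tendsto_nhdsWithin_iff.2 ⟨hv, Eventually.of_forall fun m => (x m).2.1⟩
      have hev := hw.eventually (hlsc v hvY _ hlt)
      obtain ⟨m, hm1, hm2⟩ := (hev.and (eventually_ge_atTop n)).exists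
      have h1 : (f (x m)).toReal ≤ (f (x n)).toReal := hanti hm2
      have h2 : ((f (x m)).toReal : EReal) ≤ ((f (x n)).toReal : EReal) := by exact_mod_cast h1
      rw [hcoe _ (x m).2.1 (x m).2.2, hcoe _ (x n).2.1 (x n).2.2] at h2
      exact absurd hm1 (not_lt.2 h2)
    have hvt : f v ≠ ⊤ := ne_top_of_le_ne_top (x 0).2.2 (hfv 0)
    refine ⟨⟨v, hvY, hvt⟩, ?_, ?_⟩
    · have hTlim : Tendsto (fun n => ∑' k, T (x n) v k) atTop (𝓝 (∑' _ : ℕ, (0 : ℝ))) := by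
        refine tendsto_tsum_of_dominated_convergence hgeo ?_ ?_
        · intro k
          have h1 : Tendsto (fun n => φ k (x n)) atTop (𝓝 (φ k v)) := by
            simp only [hφ]
            exact tendsto_const_nhds.div (hlimd k) ((hpos k v).1 (hvU k)).ne'
          have h2 : Tendsto (fun n => |φ k (x n) - φ k v|) atTop (𝓝 0) := by
            have := (h1.sub_const (φ k v)).abs
            simpa using this
          have h3 := (h2.div (h2.const_add 1) (by norm_num)).const_mul ((1 / 2 : ℝ) ^ (k + 1))
          simpa [T] using h3
        · refine Eventually.of_forall fun n k => ?_
          rw [Real.norm_of_nonneg (hT0 _ _ _)]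
          exact hTle _ _ _
      have := (tendsto_iff_dist_tendsto_zero.1 hv).add hTlim
      simp only [tsum_zero, add_zero] at this
      simpa only [hg'] using this
    · intro n
      have h := hfv n
      rw [← hcoe _ hvY hvt, ← hcoe _ (x n).2.1 (x n).2.2] at h
      exact_mod_cast h)
  refine ⟨v, v.2.1, fun y hy => ?_⟩
  by_cases hyt : f y = ⊤
  · rw [hyt, EReal.top_add_coe]; exact le_top
  · have h := hv ⟨y, hy, hyt⟩
    rw [← hcoe _ v.2.1 v.2.2, ← hcoe _ hy hyt]
    exact_mod_cast h
end
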